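/- arXiv:math/0212274 — 3 statements merged into one kernel-verified Lean document; each statement's English description precedes it below -/
import Mathlib

section
/- Let G be a group and N a subgroup of G. Then the following are equivalent: (1) N is a normal subgroup of G; (2) the horizontal composite of any two horizontally composable N-squares is an N-square and the vertical composite of any two vertically composable N-squares is an N-square. Here an N-square is a quadruple (a, b, c, d) of elements of G (thought of as the top, left, right and bottom edges of a square) such that (b * d)⁻¹ * (a * c) ∈ N; the horizontal composite of (a, b, c, d) and (a', c, c', d') (sharing the edge c, which is the right edge of the first and the left edge of the second) is (a * a', b, c', d * d'); the vertical composite of (a, b, c, d) and (d, b', c'', d'') (sharing the edge d, which is the bottom edge of the first and the top edge of the second) is (a, b * b', c * c'', d''). -/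
/-- An `N`-square in a group `G` with subgroup `N` is a quadruple `(a, b, c, d)`
of elements of `G` (top, left, right, bottom edges of a square) such that the
defect `(b * d)⁻¹ * (a * c)` lies in `N`. -/
def IsNSquare {G : Type} [Group G] (N : Subgroup G) (a b c d : G) : Prop :=
  (b * d)⁻¹ * (a * c) ∈ N

/-- **Normality is equivalent to composability of `N`-squares.**
Let `G` be a group and `N` a subgroup of `G`.  Then `N` is normal in `G` if and
only if the horizontal composite of any two horizontally composable `N`-squares
is an `N`-square and the vertical composite of any two vertically composable
`N`-squares is an `N`-square.  Here the horizontal composite of `(a, b, c, d)`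
and `(a', c, c', d')` is `(a * a', b, c', d * d')`, and the vertical composite of
`(a, b, c, d)` and `(d, b', c'', d'')` is `(a, b * b', c * c'', d'')`. -/
theorem normal_iff_nsquares_compose {G : Type} [Group G] (N : Subgroup G) :
    N.Normal ↔
      ((∀ a b c d a' c' d' : G, IsNSquare N a b c d → IsNSquare N a' c c' d' →
          IsNSquare N (a * a') b c' (d * d')) ∧
       (∀ a b c d b' c'' d'' : G, IsNSquare N a b c d → IsNSquare N d b' c'' d'' →
          IsNSquare N a (b * b') (c * c'') d'')) := by
  unfold IsNSquare
  constructor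
  · intro hN
    constructor
    · intro a b c d a' c' d' h₁ h₂
      have h := N.mul_mem (hN.conj_mem' _ h₁ d') h₂
      convert h using 1
      group
    · intro a b c d b' c'' d'' h₁ h₂
      have h := N.mul_mem h₂ (hN.conj_mem' _ h₁ c'')
      convert h using 1
      group
  · rintro ⟨horizontal, -⟩
    refine ⟨fun n hn g => ?_⟩
    have h := horizontal n 1 1 1 g⁻¹ 1 g⁻¹ (by simpa using hn) (by simp)
    simpa [mul_assoc] using h
end

section
/- For every natural number n ≥ 1 and any basepoint x on the unit sphere Sⁿ (the set of points of norm 1 in (n+1)-dimensional Euclidean space ℝ^{n+1}), the n-th homotopy group πₙ(Sⁿ, x) is isomorphic as a group to the integers ℤ (the Brouwer degree theorem). -/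
open scoped Topology

namespace DiscreteForm

variable {d : ℕ}

/-- The exterior algebra over `ℤ` on the standard basis covectors of the lattice `ℤᵈ`. -/
abbrev Coeff (d : ℕ) := ExteriorAlgebra ℤ (Fin d → ℤ)

/-- The basis covector in direction `k`. -/
def e (k : Fin d) : Coeff d := ExteriorAlgebra.ι ℤ (Pi.single k 1)

theorem e_mul_self (k : Fin d) : e k * e k = 0 := ExteriorAlgebra.ι_sq_zero _

theorem e_mul_e (k l : Fin d) : e k * e l = -(e l * e k) :=
  eq_neg_of_add_eq_zero_left (ExteriorAlgebra.ι_add_mul_swap _ _)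

/-- The unit lattice vector in direction `k`. -/
def unit (k : Fin d) : Fin d → ℤ := Pi.single k 1

/-- Additive operators on lattice forms. -/
abbrev Op (d : ℕ) := Module.End ℤ ((Fin d → ℤ) → Coeff d)

/-- Multiplication of lattice forms by an integer valued function. -/
def sc (s : (Fin d → ℤ) → ℤ) : Op d where
  toFun m v := s v • m v
  map_add' _ _ := by ext; simp only [Pi.add_apply, smul_add]
  map_smul' c m := by ext v; exact smul_comm (s v) c (m v)

/-- The operator `∑ₖ dxₖ`, whose graded commutators are the discrete differentials. -/
def theta : Op d where
  toFun m v := ∑ k, e k * m (v + unit k)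
  map_add' _ _ := by ext; simp [mul_add, Finset.sum_add_distrib]
  map_smul' c m := by
    ext v; simp only [Pi.smul_apply, mul_smul_comm, Finset.smul_sum, RingHom.id_apply]

/-- Multiplication by the discrete differential of a function. -/
def dd (s : (Fin d → ℤ) → ℤ) : Op d :=
  theta * sc s - sc s * theta

/-- Right multiplication by a constant form. -/
def rmul (c : Coeff d) : Op d where
  toFun m v := m v * c
  map_add' _ _ := by ext; simp [add_mul]
  map_smul' a m := by ext v; simp only [Pi.smul_apply, smul_mul_assoc, RingHom.id_apply]

theorem sc_apply (s : (Fin d → ℤ) → ℤ) (m : (Fin d → ℤ) → Coeff d) (v : Fin d → ℤ) :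
    sc s m v = s v • m v := rfl

theorem theta_apply (m : (Fin d → ℤ) → Coeff d) (v : Fin d → ℤ) :
    theta m v = ∑ k, e k * m (v + unit k) := rfl

theorem rmul_apply (c : Coeff d) (m : (Fin d → ℤ) → Coeff d) (v : Fin d → ℤ) :
    rmul c m v = m v * c := rfl

theorem dd_apply (s : (Fin d → ℤ) → ℤ) (m : (Fin d → ℤ) → Coeff d) (v : Fin d → ℤ) :
    dd s m v = ∑ k, (s (v + unit k) - s v) • (e k * m (v + unit k)) := by
  change theta (sc s m) v - sc s (theta m) v = _
  simp only [sc_apply, theta_apply, Finset.smul_sum, ← Finset.sum_sub_distrib, sub_smul,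
    mul_smul_comm]

theorem theta_mul_theta : (theta : Op d) * theta = 0 := by
  refine LinearMap.ext fun m => funext fun v => ?_
  change ∑ k, e k * ∑ l, e l * m (v + unit k + unit l) = 0
  simp only [Finset.mul_sum]
  rw [← Finset.sum_product']
  refine Finset.sum_involution (fun p _ => (p.2, p.1)) ?_ ?_ (by simp) (by simp)
  · rintro ⟨k, l⟩ -
    simp only [← mul_assoc]
    rw [e_mul_e l k, add_right_comm v (unit l), neg_mul, add_neg_cancel]
  · rintro ⟨k, l⟩ - h hkl
    obtain rfl : l = k := congrArg Prod.fst hkl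
    rw [← mul_assoc, e_mul_self, zero_mul] at h
    exact h rfl

theorem sc_add (s u : (Fin d → ℤ) → ℤ) : sc (s + u) = sc s + sc u := by
  refine LinearMap.ext fun m => funext fun v => add_smul _ _ _

theorem sc_sub (s u : (Fin d → ℤ) → ℤ) : sc (s - u) = sc s - sc u := by
  refine LinearMap.ext fun m => funext fun v => sub_smul _ _ _

theorem dd_add (s u : (Fin d → ℤ) → ℤ) : dd (s + u) = dd s + dd u := by
  rw [dd, dd, dd, sc_add, mul_add, add_mul]; abel

theorem dd_sub (s u : (Fin d → ℤ) → ℤ) : dd (s - u) = dd s - dd u := by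
  rw [dd, dd, dd, sc_sub, mul_sub, sub_mul]; abel

theorem theta_mul_sc (s : (Fin d → ℤ) → ℤ) : theta * sc s = dd s + sc s * theta := by
  rw [dd]; abel

theorem theta_mul_dd (s : (Fin d → ℤ) → ℤ) : theta * dd s = -(dd s * theta) := by
  rw [dd, mul_sub, sub_mul, mul_assoc (sc s), theta_mul_theta, ← mul_assoc theta theta,
    theta_mul_theta]
  simp [mul_assoc]

/-- The product of the differentials of a list of functions. -/
def ddProd (L : List ((Fin d → ℤ) → ℤ)) : Op d :=
  (L.map dd).prod

@[simp] theorem ddProd_nil : ddProd ([] : List ((Fin d → ℤ) → ℤ)) = 1 := rfl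

@[simp] theorem ddProd_cons (s : (Fin d → ℤ) → ℤ) (L : List ((Fin d → ℤ) → ℤ)) :
    ddProd (s :: L) = dd s * ddProd L := by simp [ddProd]

theorem ddProd_append (L L' : List ((Fin d → ℤ) → ℤ)) :
    ddProd (L ++ L') = ddProd L * ddProd L' := by simp [ddProd]

theorem theta_mul_ddProd (L : List ((Fin d → ℤ) → ℤ)) :
    theta * ddProd L = (-1) ^ L.length * (ddProd L * theta) := by
  induction L with
  | nil => simp
  | cons s L ih =>
    rw [ddProd_cons, ← mul_assoc, theta_mul_dd, neg_mul, mul_assoc, ih, List.length_cons, pow_succ,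
      ← mul_assoc (dd s), ← ((Commute.neg_one_left (dd s)).pow_left L.length).eq]
    simp [mul_assoc]

theorem commute_rmul_theta (c : Coeff d) : Commute (rmul c) theta := by
  refine LinearMap.ext fun m => funext fun v => ?_
  change (∑ k, e k * m (v + unit k)) * c = ∑ k, e k * (m (v + unit k) * c)
  simp [Finset.sum_mul, mul_assoc]

theorem commute_rmul_sc (c : Coeff d) (s : (Fin d → ℤ) → ℤ) : Commute (rmul c) (sc s) :=
  LinearMap.ext fun m => funext fun v => smul_mul_assoc (s v) (m v) c

theorem commute_rmul_dd (c : Coeff d) (s : (Fin d → ℤ) → ℤ) : Commute (rmul c) (dd s) :=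
  ((commute_rmul_theta c).mul_right (commute_rmul_sc c s)).sub_right
    ((commute_rmul_sc c s).mul_right (commute_rmul_theta c))

theorem commute_rmul_ddProd (c : Coeff d) (L : List ((Fin d → ℤ) → ℤ)) :
    Commute (rmul c) (ddProd L) := by
  induction L with
  | nil => simp
  | cons s L ih => rw [ddProd_cons]; exact (commute_rmul_dd c s).mul_right ih

/-- The sum of all basis covectors. -/
def total : Coeff d := ∑ k, e k

theorem theta_one : theta (1 : (Fin d → ℤ) → Coeff d) = rmul total 1 := by
  ext v; simp [theta_apply, rmul_apply, total]

/-- A lattice form whose values (anti)commute with the basis covectors, with sign `(-1) ^ r`. -/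
def Homogeneous (r : ℕ) (m : (Fin d → ℤ) → Coeff d) : Prop :=
  ∀ v k, e k * m v = (-1) ^ r * (m v * e k)

theorem homogeneous_one : Homogeneous 0 (1 : (Fin d → ℤ) → Coeff d) := fun v k => by simp

theorem Homogeneous.sc {r : ℕ} {m : (Fin d → ℤ) → Coeff d} (h : Homogeneous r m)
    (s : (Fin d → ℤ) → ℤ) : Homogeneous r (sc s m) := fun v k => by
  rw [sc_apply, mul_smul_comm, h v k, smul_mul_assoc, mul_smul_comm]

theorem Homogeneous.dd {r : ℕ} {m : (Fin d → ℤ) → Coeff d} (h : Homogeneous r m)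
    (s : (Fin d → ℤ) → ℤ) : Homogeneous (r + 1) (dd s m) := fun v k => by
  rw [dd_apply, Finset.mul_sum, Finset.sum_mul, Finset.mul_sum]
  refine Finset.sum_congr rfl fun l _ => ?_
  rw [mul_smul_comm, smul_mul_assoc, mul_smul_comm, ← mul_assoc, e_mul_e, neg_mul, mul_assoc, h,
    pow_succ, mul_assoc (e l), ← mul_assoc (e l),
    ← ((Commute.neg_one_left (e l)).pow_left r).eq]
  simp [mul_assoc]

theorem Homogeneous.ddProd {r : ℕ} {m : (Fin d → ℤ) → Coeff d} (h : Homogeneous r m)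
    (L : List ((Fin d → ℤ) → ℤ)) : Homogeneous (L.length + r) (ddProd L m) := by
  induction L with
  | nil => simpa using h
  | cons s L ih =>
    rw [ddProd_cons, List.length_cons, add_right_comm]
    exact ih.dd s

/-- Summation of a lattice form over all lattice points. -/
noncomputable def integral (m : (Fin d → ℤ) → Coeff d) : Coeff d := ∑ᶠ v, m v

theorem integral_zero : integral (0 : (Fin d → ℤ) → Coeff d) = 0 := finsum_zero

theorem integral_add {m m' : (Fin d → ℤ) → Coeff d} (h : m.support.Finite)
    (h' : m'.support.Finite) : integral (m + m') = integral m + integral m' :=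
  finsum_add_distrib h h'

theorem integral_sub {m m' : (Fin d → ℤ) → Coeff d} (h : m.support.Finite)
    (h' : m'.support.Finite) : integral (m - m') = integral m - integral m' :=
  finsum_sub_distrib h h'

theorem integral_neg (m : (Fin d → ℤ) → Coeff d) : integral (-m) = -integral m :=
  finsum_neg_distrib m

theorem integral_comp_add (m : (Fin d → ℤ) → Coeff d) (w : Fin d → ℤ) :
    integral (fun v => m (v + w)) = integral m :=
  finsum_comp_equiv (Equiv.addRight w)

theorem support_comp_add_finite {m : (Fin d → ℤ) → Coeff d} (h : m.support.Finite)
    (w : Fin d → ℤ) : (Function.support fun v => m (v + w)).Finite :=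
  h.preimage (add_left_injective w).injOn

theorem integral_theta {m : (Fin d → ℤ) → Coeff d} (h : m.support.Finite) :
    integral (theta m) = total * integral m := by
  simp only [integral, theta_apply]
  rw [finsum_sum_comm]
  · rw [total, Finset.sum_mul]
    refine Finset.sum_congr rfl fun k _ => ?_
    rw [← mul_finsum' (fun v => m (v + unit k)) (e k) (support_comp_add_finite h _)]
    exact congrArg (e k * ·) (integral_comp_add m _)
  · intro k _
    exact (support_comp_add_finite h (unit k)).subset fun v hv h0 => hv (by
      simp only at h0; simp [h0])

theorem integral_rmul {m : (Fin d → ℤ) → Coeff d} (h : m.support.Finite) (c : Coeff d) :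
    integral (rmul c m) = integral m * c :=
  (finsum_mul' m c h).symm

theorem support_sc_finite {s : (Fin d → ℤ) → ℤ} (hs : s.support.Finite)
    (m : (Fin d → ℤ) → Coeff d) : (sc s m).support.Finite :=
  hs.subset fun v hv h0 => hv (by simp [sc_apply, h0])

theorem support_theta_finite {m : (Fin d → ℤ) → Coeff d} (h : m.support.Finite) :
    (theta m).support.Finite := by
  refine (Set.finite_iUnion fun k => support_comp_add_finite h (unit k)).subset fun v hv => ?_
  by_contra hcon
  simp only [Set.mem_iUnion, Function.mem_support, not_exists, not_not] at hcon
  exact hv (by simp [theta_apply, hcon])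

/-- Integration by parts for the discrete differential. -/
theorem integral_by_parts {s u : (Fin d → ℤ) → ℤ} (hs : s.support.Finite)
    (A B : List ((Fin d → ℤ) → ℤ))
    (h0 : (dd s * ddProd A * sc u * ddProd B) 1 = 0) :
    integral ((sc s * ddProd A * dd u * ddProd B) 1) = 0 := by
  set X := sc s * ddProd A * sc u * ddProd B with hX
  have hfin : (X 1).support.Finite := by
    rw [hX, mul_assoc, mul_assoc]; exact support_sc_finite hs _
  have key : (-1) ^ A.length * (sc s * ddProd A * dd u * ddProd B) =
      theta * X - (-1) ^ (A.length + B.length) * (X * theta)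
        - dd s * ddProd A * sc u * ddProd B := by
    have hA : ∀ Y : Op d,
        Y * (-1) ^ A.length = (-1) ^ A.length * Y := fun Y =>
      ((Commute.neg_one_left Y).pow_left _).eq.symm
    have hB : ∀ Y : Op d,
        Y * (-1) ^ B.length = (-1) ^ B.length * Y := fun Y =>
      ((Commute.neg_one_left Y).pow_left _).eq.symm
    have h1 : theta * X = dd s * ddProd A * sc u * ddProd B
        + (-1) ^ A.length * (sc s * ddProd A * dd u * ddProd B)
        + (-1) ^ (A.length + B.length) * (X * theta) := by
      calc theta * X = (theta * sc s) * ddProd A * sc u * ddProd B := by simp [hX, mul_assoc]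
        _ = dd s * ddProd A * sc u * ddProd B
            + sc s * (theta * ddProd A) * sc u * ddProd B := by
          rw [theta_mul_sc]; noncomm_ring
        _ = dd s * ddProd A * sc u * ddProd B
            + (-1) ^ A.length * (sc s * ddProd A * (theta * sc u) * ddProd B) := by
          rw [theta_mul_ddProd, ← mul_assoc (sc s), hA]; simp only [mul_assoc]
        _ = dd s * ddProd A * sc u * ddProd B
            + (-1) ^ A.length * (sc s * ddProd A * dd u * ddProd B)
            + (-1) ^ A.length * (sc s * ddProd A * sc u * (theta * ddProd B)) := by
          rw [theta_mul_sc]; simp only [mul_add, add_mul, mul_assoc, add_assoc]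
        _ = _ := by
          rw [theta_mul_ddProd, ← mul_assoc (sc s * ddProd A * sc u), hB, pow_add, hX]
          simp only [mul_assoc]
    rw [h1]; abel
  have hXθ : (X * theta : Op d) 1 = rmul total (X 1) := by
    have hc : Commute (rmul total) X := by
      rw [hX]
      exact (((commute_rmul_sc _ s).mul_right (commute_rmul_ddProd _ A)).mul_right
        (commute_rmul_sc _ u)).mul_right (commute_rmul_ddProd _ B)
    rw [Module.End.mul_apply, theta_one]
    exact (LinearMap.congr_fun hc.eq 1).symm
  have hhom : Homogeneous (A.length + B.length) (X 1) := by
    have := ((((homogeneous_one.ddProd B).sc u).ddProd A).sc s)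
    simpa [hX, mul_assoc] using this
  have hE : total * integral (X 1) = (-1) ^ (A.length + B.length) * (integral (X 1) * total) := by
    have hc : ∀ c : Coeff d, integral (X 1) * c = ∑ᶠ v, X 1 v * c := fun c =>
      finsum_mul' _ c hfin
    have hr : (Function.support fun v => X 1 v * total).Finite := hfin.subset fun v hv h0 =>
      hv (by simp only [h0, zero_mul])
    rw [hc, mul_finsum' _ _ hr, integral, mul_finsum' _ _ hfin]
    refine finsum_congr fun v => ?_
    rw [total, Finset.sum_mul, Finset.mul_sum, Finset.mul_sum]
    exact Finset.sum_congr rfl fun k _ => hhom v k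
  have hY := LinearMap.congr_fun key 1
  rw [LinearMap.sub_apply, h0, sub_zero, LinearMap.sub_apply, Module.End.mul_apply theta] at hY
  have hθfin := support_theta_finite hfin
  have hrfin : (rmul total (X 1)).support.Finite := hfin.subset fun v hv h0 =>
    hv (by simp only [rmul_apply, h0, zero_mul])
  have hZ : integral (((-1) ^ A.length * (sc s * ddProd A * dd u * ddProd B)) 1) = 0 := by
    rw [hY]
    rcases Nat.even_or_odd (A.length + B.length) with h | h
    · rw [h.neg_one_pow, one_mul] at hE ⊢
      rw [hXθ, integral_sub hθfin hrfin, integral_theta hfin, integral_rmul hfin, hE, sub_self]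
    · rw [h.neg_one_pow, neg_one_mul] at hE ⊢
      rw [LinearMap.neg_apply, hXθ, sub_neg_eq_add, integral_add hθfin hrfin, integral_theta hfin,
        integral_rmul hfin, hE, neg_add_cancel]
  rcases Nat.even_or_odd A.length with h | h
  · rwa [h.neg_one_pow, one_mul] at hZ
  · rwa [h.neg_one_pow, neg_one_mul, LinearMap.neg_apply, integral_neg, neg_eq_zero] at hZ

/-- The discrete degree `∫ s₀ ds₁ ⋯ ds_d` of a family of `d + 1` lattice functions. -/
noncomputable def count (s : Fin (d + 1) → (Fin d → ℤ) → ℤ) : Coeff d :=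
  integral ((sc (s 0) * ddProd ((List.finRange d).map fun i => s i.succ)) 1)

theorem support_sc_mul_finite {s : (Fin d → ℤ) → ℤ} (hs : s.support.Finite) (X : Op d)
    (m : (Fin d → ℤ) → Coeff d) : ((sc s * X : Op d) m).support.Finite :=
  support_sc_finite hs (X m)

theorem prod_apply_ne_zero {ι : Type*} (φ : ι → (Fin d → ℤ) → ℝ) {η : ℝ} (hη : 0 ≤ η)
    (L : List (ι × Op d))
    (hL : ∀ p ∈ L, ∀ m v, p.2 m v ≠ 0 →
      |φ p.1 v| ≤ 2 * η ∧ ∃ w, m w ≠ 0 ∧ ∀ i, |φ i v| ≤ |φ i w| + η)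
    (m : (Fin d → ℤ) → Coeff d) (v : Fin d → ℤ) (h : (L.map Prod.snd).prod m v ≠ 0) :
    ∀ p ∈ L, |φ p.1 v| ≤ (L.length + 2) * η := by
  induction L generalizing v with
  | nil => simp
  | cons q L ih =>
    rw [List.map_cons, List.prod_cons, Module.End.mul_apply] at h
    obtain ⟨h1, w, hw, h2⟩ := hL q (by simp) _ v h
    intro p hp
    rcases List.mem_cons.1 hp with rfl | hp
    · have : (0 : ℝ) ≤ ((p :: L).length : ℝ) * η := by positivity
      linarith
    · have := ih (fun p hp => hL p (by simp [hp])) w hw p hp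
      have := h2 p.1
      push_cast [List.length_cons]
      linarith

theorem dd_apply_ne_zero {s : (Fin d → ℤ) → ℤ} {m : (Fin d → ℤ) → Coeff d} {v : Fin d → ℤ}
    (h : dd s m v ≠ 0) : ∃ k, s (v + unit k) ≠ s v ∧ m (v + unit k) ≠ 0 := by
  rw [dd_apply] at h
  obtain ⟨k, -, hk⟩ := Finset.exists_ne_zero_of_sum_ne_zero h
  refine ⟨k, fun h0 => hk ?_, fun h0 => hk ?_⟩
  · rw [h0, sub_self, zero_smul]
  · rw [h0, mul_zero, smul_zero]

/-- The discrete degree is unchanged if the labels are modified only where the corresponding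
coordinate function is small, provided the coordinate functions are nowhere simultaneously
small. -/
theorem count_congr (φ : Fin (d + 1) → (Fin d → ℤ) → ℝ) {η : ℝ} (hη : 0 ≤ η)
    (hφ : ∀ i v k, |φ i (v + unit k) - φ i v| ≤ η) (hφ' : ∀ v, ∃ i, (d + 3) * η < |φ i v|)
    (s u : Fin (d + 1) → (Fin d → ℤ) → ℤ)
    (hs0 : (s 0).support.Finite) (hu0 : (u 0).support.Finite)
    (hs : ∀ i v k, s i (v + unit k) ≠ s i v → |φ i v| ≤ 2 * η)
    (hu : ∀ i v k, u i (v + unit k) ≠ u i v → |φ i v| ≤ 2 * η)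
    (hsu : ∀ i v, s i v ≠ u i v → |φ i v| ≤ 2 * η) :
    count s = count u := by
  have hstep : ∀ v k i, |φ i v| ≤ |φ i (v + unit k)| + η := fun v k i => by
    have := abs_sub_abs_le_abs_sub (φ i v) (φ i (v + unit k))
    rw [abs_sub_comm] at this
    linarith [hφ i v k]
  have hdd : ∀ (i : Fin (d + 1)) (g : (Fin d → ℤ) → ℤ),
      (∀ v k, g (v + unit k) ≠ g v → |φ i v| ≤ 2 * η) → ∀ m v, dd g m v ≠ 0 →
      |φ i v| ≤ 2 * η ∧ ∃ w, m w ≠ 0 ∧ ∀ j, |φ j v| ≤ |φ j w| + η := fun i g hg m v h => by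
    obtain ⟨k, h1, h2⟩ := dd_apply_ne_zero h
    exact ⟨hg v k h1, _, h2, hstep v k⟩
  have hsc : ∀ i m v, sc (s i - u i) m v ≠ 0 →
      |φ i v| ≤ 2 * η ∧ ∃ w, m w ≠ 0 ∧ ∀ j, |φ j v| ≤ |φ j w| + η := fun i m v h => by
    rw [sc_apply] at h
    refine ⟨hsu i v fun h0 => h ?_, v, fun h0 => h ?_, fun j => by linarith⟩
    · rw [Pi.sub_apply, h0, sub_self, zero_smul]
    · rw [h0, smul_zero]
  have hvanish : ∀ L : List (Fin (d + 1) × Op d), L.length = d + 1 → (∀ i, i ∈ L.map Prod.fst) →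
      (∀ p ∈ L, ∀ m v, p.2 m v ≠ 0 →
        |φ p.1 v| ≤ 2 * η ∧ ∃ w, m w ≠ 0 ∧ ∀ i, |φ i v| ≤ |φ i w| + η) →
      (L.map Prod.snd).prod 1 = 0 := fun L hlen hall hloc => by
    by_contra hne
    obtain ⟨v, hv⟩ := Function.ne_iff.1 hne
    obtain ⟨i, hi⟩ := hφ' v
    obtain ⟨p, hp, rfl⟩ := List.mem_map.1 (hall i)
    have := prod_apply_ne_zero φ hη L hloc 1 v hv p hp
    rw [hlen] at this
    push_cast at this
    linarith
  have hsub : ∀ (g : (Fin d → ℤ) → ℤ) (X Y : Op d), g.support.Finite →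
      integral ((sc g * (X - Y)) 1) = 0 → integral ((sc g * X) 1) = integral ((sc g * Y) 1) :=
    fun g X Y hg h => by
      rw [mul_sub, LinearMap.sub_apply, integral_sub (support_sc_mul_finite hg _ _)
        (support_sc_mul_finite hg _ _)] at h
      exact sub_eq_zero.1 h
  have hmain : ∀ I₂ I₁ : List (Fin d), I₁ ++ I₂ = List.finRange d →
      integral ((sc (s 0) * (ddProd (I₁.map fun i => u i.succ) *
        ddProd (I₂.map fun i => s i.succ))) 1) =
      integral ((sc (s 0) * ddProd ((List.finRange d).map fun i => u i.succ)) 1) := by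
    intro I₂
    induction I₂ with
    | nil => intro I₁ h; rw [← h]; simp
    | cons j I₂ ih =>
      intro I₁ h
      rw [← ih (I₁ ++ [j]) (by simpa using h)]
      refine hsub _ _ _ hs0 ?_
      have hrew : sc (s 0) * (ddProd (I₁.map fun i => u i.succ) *
          ddProd ((j :: I₂).map fun i => s i.succ) -
          ddProd ((I₁ ++ [j]).map fun i => u i.succ) * ddProd (I₂.map fun i => s i.succ)) =
          sc (s 0) * ddProd (I₁.map fun i => u i.succ) * dd (s j.succ - u j.succ) *
            ddProd (I₂.map fun i => s i.succ) := by
        simp only [List.map_cons, ddProd_cons, List.map_append, ddProd_append, dd_sub,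
          List.map_nil, ddProd_nil, mul_one]
        noncomm_ring
      rw [hrew]
      refine integral_by_parts hs0 _ _ ?_
      have := hvanish ((0, dd (s 0)) :: (I₁.map fun i => (i.succ, dd (u i.succ))) ++
        (j.succ, sc (s j.succ - u j.succ)) :: I₂.map fun i => (i.succ, dd (s i.succ))) ?_ ?_ ?_
      · rw [← this]
        simp [ddProd, Function.comp_def, mul_assoc]
      · have := congrArg List.length h
        simp at this ⊢
        omega
      · intro i
        induction i using Fin.cases with
        | zero => simp
        | succ i =>
          have : i ∈ I₁ ++ j :: I₂ := h ▸ List.mem_finRange i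
          simp at this ⊢
          tauto
      · intro p hp
        simp only [List.cons_append, List.mem_cons, List.mem_append, List.mem_map] at hp
        rcases hp with rfl | ⟨i, -, rfl⟩ | rfl | ⟨i, -, rfl⟩
        · exact hdd _ _ (hs _)
        · exact hdd _ _ (hu _)
        · exact hsc _
        · exact hdd _ _ (hs _)
  have h1 := hmain (List.finRange d) [] rfl
  simp only [List.map_nil, ddProd_nil, one_mul] at h1
  rw [count, count, h1, ← sub_eq_zero, ← integral_sub (support_sc_mul_finite hs0 _ _)
    (support_sc_mul_finite hu0 _ _), ← LinearMap.sub_apply, ← sub_mul, ← sc_sub]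
  have := hvanish ((0, sc (s 0 - u 0)) :: (List.finRange d).map fun i =>
    (i.succ, dd (u i.succ))) (by simp) ?_ ?_
  · simp only [List.map_cons, List.map_map, List.prod_cons, Function.comp_def] at this
    simp only [ddProd, List.map_map, Function.comp_def]
    rw [this, integral_zero]
  · intro i
    induction i using Fin.cases with
    | zero => simp
    | succ i => simp
  · intro p hp
    simp only [List.mem_cons, List.mem_map] at hp
    rcases hp with rfl | ⟨i, -, rfl⟩
    · exact hsc _
    · exact hdd _ _ (hu _)

theorem sc_mul_dd_eq_zero {s u : (Fin d → ℤ) → ℤ} (h : ∀ v, s v * u v = 0)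
    (h' : ∀ v k, s v * u (v + unit k) = 0) : sc s * dd u = 0 := by
  refine LinearMap.ext fun m => funext fun v => ?_
  rw [Module.End.mul_apply, sc_apply, dd_apply, Finset.smul_sum]
  refine Finset.sum_eq_zero fun k _ => ?_
  rw [smul_smul, mul_sub, h, h', sub_zero, zero_smul]

theorem dd_mul_dd_eq_zero {s u : (Fin d → ℤ) → ℤ} (h : ∀ v, s v * u v = 0)
    (h' : ∀ v k, s v * u (v + unit k) = 0) : dd s * dd u = 0 := by
  have h0 := sc_mul_dd_eq_zero h h'
  rw [dd, sub_mul, mul_assoc, mul_assoc, h0, theta_mul_dd, mul_neg, ← mul_assoc (sc s), h0]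
  simp

/-- The discrete degree is additive for families of functions with separated supports. -/
theorem count_add (hd : d ≠ 0) (s u : Fin (d + 1) → (Fin d → ℤ) → ℤ)
    (hs0 : (s 0).support.Finite) (hu0 : (u 0).support.Finite)
    (h : ∀ i j v, s i v * u j v = 0) (hsu : ∀ i j v k, s i v * u j (v + unit k) = 0)
    (hus : ∀ i j v k, u i v * s j (v + unit k) = 0) :
    count (s + u) = count s + count u := by
  have h' : ∀ i j v, u i v * s j v = 0 := fun i j v => by rw [mul_comm, h]
  have key : ∀ I : List (Fin d), I ≠ [] → ddProd (I.map fun i => (s + u) i.succ) =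
      ddProd (I.map fun i => s i.succ) + ddProd (I.map fun i => u i.succ) := by
    intro I hI
    induction I with
    | nil => exact absurd rfl hI
    | cons i I ih =>
      rcases I with - | ⟨j, I⟩
      · simp [dd_add]
      · simp only [List.map_cons, ddProd_cons] at ih ⊢
        rw [ih (by simp), Pi.add_apply, dd_add, mul_add, add_mul, add_mul,
          ← mul_assoc (dd (u i.succ)) (dd (s j.succ)), ← mul_assoc (dd (s i.succ)) (dd (u j.succ)),
          dd_mul_dd_eq_zero (h' _ _) (hus _ _), dd_mul_dd_eq_zero (h _ _) (hsu _ _)]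
        simp
  have hne : List.finRange d ≠ [] := by simpa using hd
  rw [count, key _ hne, Pi.add_apply, sc_add, mul_add, add_mul, add_mul]
  obtain ⟨j, I, hI⟩ := List.exists_cons_of_ne_nil hne
  have h1 : sc (u 0) * ddProd ((List.finRange d).map fun i => s i.succ) = 0 := by
    rw [hI, List.map_cons, ddProd_cons, ← mul_assoc, sc_mul_dd_eq_zero (h' _ _) (hus _ _), zero_mul]
  have h2 : sc (s 0) * ddProd ((List.finRange d).map fun i => u i.succ) = 0 := by
    rw [hI, List.map_cons, ddProd_cons, ← mul_assoc, sc_mul_dd_eq_zero (h _ _) (hsu _ _), zero_mul]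
  rw [h1, h2, add_zero, zero_add, LinearMap.add_apply, integral_add (support_sc_mul_finite hs0 _ _)
    (support_sc_mul_finite hu0 _ _), count, count]

theorem ddProd_shift (I : List (Fin d)) (s : Fin (d + 1) → (Fin d → ℤ) → ℤ) (w v : Fin d → ℤ) :
    ddProd (I.map fun i x => s i.succ (x + w)) 1 v =
      ddProd (I.map fun i => s i.succ) 1 (v + w) := by
  induction I generalizing v with
  | nil => rfl
  | cons i I ih =>
    simp only [List.map_cons, ddProd_cons, Module.End.mul_apply, dd_apply, ih,
      add_right_comm v w]

theorem count_shift (s : Fin (d + 1) → (Fin d → ℤ) → ℤ) (w : Fin d → ℤ) :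
    count (fun i v => s i (v + w)) = count s := by
  refine Eq.trans (congrArg integral (funext fun v => ?_)) (integral_comp_add _ w)
  rw [Module.End.mul_apply, Module.End.mul_apply, sc_apply, sc_apply, ddProd_shift]

theorem ddProd_congr (I : List (Fin d)) (s u : Fin d → (Fin d → ℤ) → ℤ) (v : Fin d → ℤ)
    (h : ∀ w, (∀ l, v l ≤ w l ∧ w l ≤ v l + I.length) → ∀ i ∈ I, s i w = u i w) :
    ddProd (I.map s) 1 v = ddProd (I.map u) 1 v := by
  induction I generalizing v with
  | nil => rfl
  | cons i I ih =>
    simp only [List.map_cons, ddProd_cons, Module.End.mul_apply, dd_apply]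
    have hle : ∀ k l, 0 ≤ (unit k : Fin d → ℤ) l ∧ (unit k : Fin d → ℤ) l ≤ 1 := fun k l => by
      by_cases hkl : l = k <;> simp [unit, hkl]
    refine Finset.sum_congr rfl fun k _ => ?_
    rw [h v (fun l => by simp; positivity) i (by simp), h (v + unit k) (fun l => by
      have := hle k l
      push_cast [List.length_cons, Pi.add_apply]
      constructor <;> [linarith; skip]
      have : (0 : ℤ) ≤ I.length := by positivity
      linarith) i (by simp), ih (v + unit k) fun w hw j hj => h w (fun l => by
      have := hle k l
      have := hw l
      push_cast [List.length_cons]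
      rw [Pi.add_apply] at this
      constructor <;> linarith) j (by simp [hj])]

/-- The differentials of the indicator functions of coordinate half spaces multiply to the
volume form concentrated at one point. -/
theorem ddProd_halfSpace (c : Fin d → ℤ) (I : List (Fin d)) (hI : I.Nodup) (v : Fin d → ℤ) :
    ddProd (I.map fun i (v : Fin d → ℤ) => if c i < v i then (1 : ℤ) else 0) 1 v =
      if ∀ i ∈ I, v i = c i then (I.map e).prod else 0 := by
  induction I generalizing v with
  | nil => simp
  | cons i I ih =>
    rw [List.nodup_cons] at hI
    simp only [List.map_cons, ddProd_cons, Module.End.mul_apply, dd_apply]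
    rw [Finset.sum_eq_single i]
    · rw [ih hI.2]
      have h1 : ∀ j ∈ I, (v + unit i) j = v j := fun j hj => by
        simp [unit, show j ≠ i from fun h => hI.1 (h ▸ hj)]
      have h2 : (∀ j ∈ I, (v + unit i) j = c j) ↔ ∀ j ∈ I, v j = c j :=
        forall₂_congr fun j hj => by rw [h1 j hj]
      have h3 : (v + unit i) i = v i + 1 := by simp [unit]
      simp only [h2, h3, List.forall_mem_cons, List.prod_cons]
      by_cases hA : ∀ j ∈ I, v j = c j
      · rcases lt_trichotomy (v i) (c i) with hv | hv | hv
        · simp [hv.ne, not_lt.2 hv.le, not_lt.2 (Int.add_one_le_of_lt hv)]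
        · simp [hv]
        · simp [hv.ne', hv, hv.trans (Int.lt_succ _)]
      · simp [hA]
    · intro k _ hk
      simp [unit, Ne.symm hk]
    · simp

/-- The volume form. -/
def vol (d : ℕ) : Coeff d := ((List.finRange d).map e).prod

theorem smul_vol_eq_zero {a : ℤ} (h : a • vol d = 0) : a = 0 := by
  have h1 : vol d = ExteriorAlgebra.ιMulti ℤ d (fun i => Pi.single i 1) := by
    rw [ExteriorAlgebra.ιMulti_apply, List.ofFn_eq_map]; rfl
  have h2 := congrArg (ExteriorAlgebra.liftAlternating (R := ℤ) (M := Fin d → ℤ) (N := ℤ)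
    (Pi.single d Matrix.detRowAlternating)) h
  rw [map_smul, h1, ExteriorAlgebra.liftAlternating_apply_ιMulti, map_zero, Pi.single_eq_same] at h2
  have h3 : Matrix.detRowAlternating (fun i : Fin d => (Pi.single i 1 : Fin d → ℤ)) = 1 := by
    rw [← Matrix.det_one (n := Fin d)]
    refine congrArg Matrix.det ?_
    ext i j
    simp [Matrix.one_apply, Pi.single_apply, eq_comm]
  simpa [h3] using h2

theorem count_eq_vol (c : Fin d → ℤ) (s : Fin (d + 1) → (Fin d → ℤ) → ℤ) (hc : s 0 c = 1)
    (hs : ∀ v, s 0 v ≠ 0 → ∀ w, (∀ l, v l ≤ w l ∧ w l ≤ v l + d) → ∀ i : Fin d,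
      s i.succ w = if c i < w i then 1 else 0) : count s = vol d := by
  have : (sc (s 0) * ddProd ((List.finRange d).map fun i => s i.succ)) 1 =
      fun v => if v = c then vol d else 0 := by
    funext v
    rw [Module.End.mul_apply, sc_apply]
    by_cases h0 : s 0 v = 0
    · rw [h0, zero_smul, if_neg]
      rintro rfl
      omega
    · rw [ddProd_congr _ _ (fun i (v : Fin d → ℤ) => if c i < v i then (1 : ℤ) else 0) v
        (fun w hw i _ => hs v h0 w (by simpa using hw) i),
        ddProd_halfSpace _ _ (List.nodup_finRange d)]
      by_cases hv : v = c
      · simp [hv, hc, vol]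
      · rw [if_neg, if_neg hv, smul_zero]
        simpa [funext_iff] using hv
  rw [count, this, integral, finsum_eq_single _ c (fun v hv => if_neg hv), if_pos rfl]

end DiscreteForm

namespace SphereDegree

open DiscreteForm
open scoped unitInterval Topology.Homotopy

variable {d : ℕ}

/-- The unit sphere in `ℝ^{d+1}`. -/
abbrev Sph (d : ℕ) := Metric.sphere (0 : EuclideanSpace ℝ (Fin (d + 1))) 1

/-- The standard base point of the sphere. -/
noncomputable def north (d : ℕ) : Sph d := ⟨EuclideanSpace.single 0 1, by simp⟩

theorem north_zero : (north d).1 0 = 1 := by simp [north]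

theorem north_succ (i : Fin d) : (north d).1 i.succ = 0 := by simp [north]

/-- The point of the cube with dyadic coordinates `v l / 2 ^ j l`. -/
noncomputable def grid (j : Fin d → ℕ) (v : Fin d → ℤ) : I^ Fin d :=
  fun l => Set.projIcc 0 1 zero_le_one ((v l : ℝ) / 2 ^ j l)

/-- The indicator functions of the conditions `f₀ < 0` and `0 < fᵢ`, restricted to a grid. -/
noncomputable def labels (f : (I^ Fin d) → Sph d) (j : Fin d → ℕ) :
    Fin (d + 1) → (Fin d → ℤ) → ℤ :=
  Fin.cases (fun v => if (f (grid j v)).1 0 < 0 then 1 else 0)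
    (fun i v => if 0 < (f (grid j v)).1 i.succ then 1 else 0)

theorem labels_zero (f : (I^ Fin d) → Sph d) (j : Fin d → ℕ) (v : Fin d → ℤ) :
    labels f j 0 v = if (f (grid j v)).1 0 < 0 then 1 else 0 := rfl

theorem labels_succ (f : (I^ Fin d) → Sph d) (j : Fin d → ℕ) (i : Fin d) (v : Fin d → ℤ) :
    labels f j i.succ v = if 0 < (f (grid j v)).1 i.succ then 1 else 0 := rfl

theorem labels_eq_of_eq {f g : (I^ Fin d) → Sph d} {j j' : Fin d → ℕ} {v w : Fin d → ℤ}
    (h : f (grid j v) = g (grid j' w)) (i : Fin (d + 1)) : labels f j i v = labels g j' i w := by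
  induction i using Fin.cases with
  | zero => rw [labels_zero, labels_zero, h]
  | succ i => rw [labels_succ, labels_succ, h]

theorem labels_eq_zero {f : (I^ Fin d) → Sph d} {j : Fin d → ℕ} {v : Fin d → ℤ}
    (h : f (grid j v) = north d) (i : Fin (d + 1)) : labels f j i v = 0 := by
  induction i using Fin.cases with
  | zero => rw [labels_zero, h, north_zero, if_neg (by norm_num)]
  | succ i => rw [labels_succ, h, north_succ, if_neg (by norm_num)]

theorem grid_mem_boundary {j : Fin d → ℕ} {v : Fin d → ℤ} (l : Fin d)
    (h : v l ≤ 0 ∨ 2 ^ j l ≤ v l) : grid j v ∈ Cube.boundary (Fin d) := by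
  refine ⟨l, h.imp (fun h => ?_) fun h => ?_⟩
  · refine Set.projIcc_of_le_left _ (div_nonpos_of_nonpos_of_nonneg ?_ (by positivity))
    exact_mod_cast h
  · refine Set.projIcc_of_right_le _ ?_
    rw [one_le_div (by positivity)]
    exact_mod_cast h

theorem labels_ne_zero {f : (I^ Fin d) → Sph d} (hf : ∀ y ∈ Cube.boundary (Fin d), f y = north d)
    {j : Fin d → ℕ} {v : Fin d → ℤ} {i : Fin (d + 1)} (h : labels f j i v ≠ 0) (l : Fin d) :
    0 < v l ∧ v l < 2 ^ j l := by
  by_contra h0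
  refine h (labels_eq_zero (hf _ (grid_mem_boundary l ?_)) i)
  rw [not_and_or, not_lt, not_lt] at h0
  exact h0

theorem support_labels_finite {f : (I^ Fin d) → Sph d}
    (hf : ∀ y ∈ Cube.boundary (Fin d), f y = north d) (j : Fin d → ℕ) (i : Fin (d + 1)) :
    (labels f j i).support.Finite := by
  refine (Set.finite_Icc (0 : Fin d → ℤ) (fun l => 2 ^ j l)).subset fun v hv => ?_
  exact ⟨fun l => (labels_ne_zero hf hv l).1.le, fun l => (labels_ne_zero hf hv l).2.le⟩

theorem dist_grid_le {j : Fin d → ℕ} {j0 : ℕ} (hj : ∀ l, j0 ≤ j l) (v : Fin d → ℤ) (k : Fin d) :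
    dist (grid j (v + unit k)) (grid j v) ≤ 1 / 2 ^ j0 := by
  rw [dist_pi_le_iff (by positivity)]
  intro l
  have hlip : ∀ a b : ℝ, dist (Set.projIcc (0 : ℝ) 1 zero_le_one a)
      (Set.projIcc (0 : ℝ) 1 zero_le_one b) ≤ |a - b| := fun a b => by
    rw [Subtype.dist_eq, Real.dist_eq]
    simp only [Set.coe_projIcc]
    exact (abs_max_sub_max_le_max _ _ _ _).trans (by
      simpa using (abs_min_sub_min_le_max 1 a 1 b))
  refine (hlip _ _).trans ?_
  rw [← sub_div, abs_div, abs_of_pos (by positivity : (0 : ℝ) < 2 ^ j l)]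
  refine div_le_div₀ zero_le_one ?_ (by positivity) (pow_le_pow_right₀ one_le_two (hj l))
  by_cases hkl : l = k <;> simp [unit, hkl]

theorem abs_coord_sub_le (x y : Sph d) (i : Fin (d + 1)) : |x.1 i - y.1 i| ≤ dist x y := by
  rw [Subtype.dist_eq, dist_eq_norm]
  exact PiLp.norm_apply_le (x.1 - y.1) i

theorem exists_lt_abs_coord (x : Sph d) :
    ∃ i, ((d : ℝ) + 3) * (1 / ((d + 1) * (d + 4))) < |x.1 i| := by
  by_contra! h
  have h1 : ∑ i, (x.1 i) ^ 2 = 1 := by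
    have := EuclideanSpace.norm_sq_eq x.1
    rw [mem_sphere_zero_iff_norm.1 x.2] at this
    simpa using this.symm
  have h2 : ∀ i, (x.1 i) ^ 2 ≤ (((d : ℝ) + 3) * (1 / ((d + 1) * (d + 4)))) ^ 2 := fun i =>
    sq_le_sq' (abs_le.1 (h i)).1 (abs_le.1 (h i)).2
  have h3 := Finset.sum_le_sum fun i (_ : i ∈ Finset.univ) => h2 i
  rw [h1] at h3
  simp only [Finset.sum_const, Finset.card_univ, Fintype.card_fin, nsmul_eq_mul] at h3
  have hd : (0 : ℝ) ≤ d := Nat.cast_nonneg d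
  push_cast at h3
  have h4 : ((d : ℝ) + 1) * ((d + 3) * (1 / ((d + 1) * (d + 4)))) ^ 2 =
      (d + 3) ^ 2 / ((d + 1) * (d + 4) ^ 2) := by
    field_simp
  rw [h4, le_div_iff₀ (by positivity)] at h3
  nlinarith

theorem count_labels_eq_of_close {f g : (I^ Fin d) → Sph d}
    (hf : ∀ y ∈ Cube.boundary (Fin d), f y = north d)
    (hg : ∀ y ∈ Cube.boundary (Fin d), g y = north d) {j : Fin d → ℕ}
    (hf' : ∀ v k, dist (f (grid j (v + unit k))) (f (grid j v)) ≤ 1 / ((d + 1) * (d + 4)))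
    (hg' : ∀ v k, dist (g (grid j (v + unit k))) (g (grid j v)) ≤ 1 / ((d + 1) * (d + 4)))
    (hfg : ∀ y, dist (f y) (g y) ≤ 1 / ((d + 1) * (d + 4))) :
    count (labels f j) = count (labels g j) := by
  set η : ℝ := 1 / ((d + 1) * (d + 4)) with hη
  have hη0 : 0 ≤ η := by positivity
  have key : ∀ (p q : (I^ Fin d) → Sph d) (v w : Fin d → ℤ) (i : Fin (d + 1)),
      labels p j i v ≠ labels q j i w →
      |(q (grid j w)).1 i| ≤ dist (p (grid j v)) (q (grid j w)) := by
    intro p q v w i h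
    refine le_trans ?_ (abs_coord_sub_le _ _ i)
    induction i using Fin.cases with
    | zero =>
      rw [labels_zero, labels_zero] at h
      split_ifs at h with h1 h2 h2
      · exact absurd rfl h
      · rw [abs_of_nonneg (not_lt.1 h2), abs_sub_comm]
        exact (by linarith : _ ≤ _).trans (le_abs_self _)
      · rw [abs_of_neg h2]
        exact (by linarith : _ ≤ _).trans (le_abs_self _)
      · exact absurd rfl h
    | succ i =>
      rw [labels_succ, labels_succ] at h
      split_ifs at h with h1 h2 h2
      · exact absurd rfl h
      · rw [abs_of_nonpos (not_lt.1 h2)]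
        exact (by linarith : _ ≤ _).trans (le_abs_self _)
      · rw [abs_of_pos h2, abs_sub_comm]
        exact (by linarith : _ ≤ _).trans (le_abs_self _)
      · exact absurd rfl h
  have hfg' : ∀ y i, |(f y).1 i| ≤ |(g y).1 i| + η := fun y i => by
    have := abs_sub_abs_le_abs_sub ((f y).1 i) ((g y).1 i)
    linarith [(abs_coord_sub_le (f y) (g y) i).trans (hfg y)]
  refine count_congr (fun i v => (f (grid j v)).1 i) hη0
    (fun i v k => (abs_coord_sub_le _ _ i).trans (hf' v k)) (fun v => exists_lt_abs_coord _) _ _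
    (support_labels_finite hf j 0) (support_labels_finite hg j 0) (fun i v k h => ?_)
    (fun i v k h => ?_) (fun i v h => ?_)
  · linarith [(key f f _ _ i h).trans (hf' v k)]
  · linarith [(key g g _ _ i h).trans (hg' v k), hfg' (grid j v) i]
  · have := (key g f _ _ i h.symm)
    rw [dist_comm] at this
    linarith [hfg (grid j v)]

theorem exists_count_labels_eq_of_homotopic {f g : Ω^ (Fin d) (Sph d) (north d)}
    (h : GenLoop.Homotopic f g) :
    ∃ j0 : ℕ, ∀ j : Fin d → ℕ, (∀ l, j0 ≤ j l) → count (labels f j) = count (labels g j) := by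
  obtain ⟨H⟩ := h
  set η : ℝ := 1 / ((d + 1) * (d + 4)) with hη
  have hη0 : 0 < η := by positivity
  have huc : UniformContinuous H := CompactSpace.uniformContinuous_of_continuous H.continuous
  obtain ⟨δ, hδ, hH⟩ := Metric.uniformContinuous_iff.1 huc η hη0
  obtain ⟨j0, hj0⟩ := exists_pow_lt_of_lt_one hδ (by norm_num : (1 / 2 : ℝ) < 1)
  obtain ⟨m, hm⟩ := exists_nat_one_div_lt hδ
  refine ⟨j0, fun j hj => ?_⟩
  have hbd : ∀ t, ∀ y ∈ Cube.boundary (Fin d), H (t, y) = north d := fun t y hy => by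
    rw [H.eq_fst t hy]; exact f.2 y hy
  have hstep : ∀ t v k, dist (H (t, grid j (v + unit k))) (H (t, grid j v)) ≤ η := fun t v k => by
    refine (hH ?_).le
    rw [Prod.dist_eq, dist_self, max_eq_right dist_nonneg]
    refine (dist_grid_le hj v k).trans_lt ?_
    rwa [one_div_pow] at hj0
  have key : ∀ k : ℕ, count (labels f j) =
      count (labels (fun y => H (Set.projIcc 0 1 zero_le_one ((k : ℝ) / (m + 1)), y)) j) := by
    intro k
    induction k with
    | zero =>
      congr 2
      funext y
      simp
    | succ k ih =>
      rw [ih]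
      refine count_labels_eq_of_close (hbd _) (hbd _) (hstep _) (hstep _) fun y => (hH ?_).le
      rw [Prod.dist_eq, dist_self, max_eq_left dist_nonneg, Subtype.dist_eq, Real.dist_eq]
      simp only [Set.coe_projIcc]
      refine lt_of_le_of_lt ((abs_max_sub_max_le_max _ _ _ _).trans (by
        simpa using (abs_min_sub_min_le_max 1 ((k : ℝ) / (m + 1)) 1 ((k + 1 : ℕ) / (m + 1))))) ?_
      rw [← sub_div]
      rw [sub_add_cancel_left, abs_div, abs_neg, abs_one, abs_of_pos (by positivity)]
      exact hm
  rw [key (m + 1)]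
  congr 2
  funext y
  rw [Set.projIcc_of_right_le]
  · exact H.apply_one y
  · push_cast; rw [div_self (by positivity)]

/-- The assertion that a loop has degree `a`, computed on all sufficiently fine dyadic grids. -/
def HasDegree (f : (I^ Fin d) → Sph d) (a : ℤ) : Prop :=
  ∃ j0 : ℕ, ∀ j : Fin d → ℕ, (∀ l, j0 ≤ j l) → count (labels f j) = a • vol d

theorem HasDegree.unique {f : (I^ Fin d) → Sph d} {a b : ℤ} (ha : HasDegree f a)
    (hb : HasDegree f b) : a = b := by
  obtain ⟨i, hi⟩ := ha
  obtain ⟨j, hj⟩ := hb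
  have h := (hi (fun _ => max i j) fun _ => le_max_left _ _).symm.trans
    (hj (fun _ => max i j) fun _ => le_max_right _ _)
  rw [← sub_eq_zero, ← sub_smul] at h
  exact sub_eq_zero.1 (smul_vol_eq_zero h)

theorem HasDegree.congr {f g : Ω^ (Fin d) (Sph d) (north d)} {a : ℤ}
    (hf : HasDegree f a) (h : GenLoop.Homotopic f g) : HasDegree g a := by
  obtain ⟨i, hi⟩ := hf
  obtain ⟨j, hj⟩ := exists_count_labels_eq_of_homotopic h
  exact ⟨max i j, fun k hk => by
    rw [← hj k fun l => (le_max_right _ _).trans (hk l),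
      hi k fun l => (le_max_left _ _).trans (hk l)]⟩

theorem hasDegree_const : HasDegree (GenLoop.const : Ω^ (Fin d) (Sph d) (north d)) 0 := by
  refine ⟨0, fun j _ => ?_⟩
  have : labels (GenLoop.const : Ω^ (Fin d) (Sph d) (north d)) j 0 = 0 :=
    funext fun v => labels_eq_zero rfl 0
  rw [count, this, zero_smul]
  have h0 : sc (0 : (Fin d → ℤ) → ℤ) = 0 := LinearMap.ext fun m => funext fun v => zero_smul _ _
  rw [h0, zero_mul, LinearMap.zero_apply, integral_zero]

theorem transAt_grid (i : Fin d) (f g : Ω^ (Fin d) (Sph d) (north d)) (j : Fin d → ℕ)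
    (v : Fin d → ℤ) :
    GenLoop.transAt i f g (grid (Function.update j i (j i + 1)) v) =
      if v i ≤ 2 ^ j i then f (grid j v) else g (grid j (v - Pi.single i (2 ^ j i))) := by
  have hpos : (0 : ℝ) < 2 ^ j i := by positivity
  set t : ℝ := (v i : ℝ) / 2 ^ j i with ht
  have h1 : grid (Function.update j i (j i + 1)) v i = Set.projIcc 0 1 zero_le_one (t / 2) := by
    rw [grid, Function.update_self, pow_succ, ht, div_div]
  have hcond : ((grid (Function.update j i (j i + 1)) v i : I) : ℝ) ≤ 1 / 2 ↔ v i ≤ 2 ^ j i := by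
    have h2 : v i ≤ 2 ^ j i ↔ t ≤ 1 := by
      rw [ht, div_le_one hpos]; exact_mod_cast Iff.rfl
    rw [h1, Set.coe_projIcc, h2, max_le_iff, min_le_iff]
    constructor
    · rintro ⟨-, h | h⟩ <;> linarith
    · intro h; exact ⟨by norm_num, Or.inr (by linarith)⟩
  have hother : ∀ (w : Fin d → ℤ) l, l ≠ i → w l = v l →
      grid (Function.update j i (j i + 1)) v l = grid j w l := fun w l hl hw => by
    rw [grid, grid, Function.update_of_ne hl, hw]
  have h0 : GenLoop.transAt i f g (grid (Function.update j i (j i + 1)) v) = _ :=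
    congrFun (GenLoop.coe_copy _ _) _
  rw [h0]
  split_ifs with h3 h4 h4
  · refine congrArg f (funext fun l => ?_)
    by_cases hl : l = i
    · subst hl
      rw [Function.update_self, h1, grid, ← ht]
      refine Subtype.ext ?_
      rw [h1] at h3
      simp only [Set.coe_projIcc] at h3 ⊢
      grind
    · rw [Function.update_of_ne hl, hother v l hl rfl]
  · exact absurd (hcond.1 h3) h4
  · exact absurd (hcond.2 h4) h3
  · refine congrArg g (funext fun l => ?_)
    by_cases hl : l = i
    · subst hl
      have h5 : (((v - Pi.single l (2 ^ j l) : Fin d → ℤ) l : ℤ) : ℝ) / 2 ^ j l = t - 1 := by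
        rw [Pi.sub_apply, Pi.single_eq_same]
        push_cast
        rw [sub_div, div_self hpos.ne']
      rw [Function.update_self, h1, grid, h5]
      refine Subtype.ext ?_
      rw [h1] at h3
      simp only [Set.coe_projIcc] at h3 ⊢
      grind
    · rw [Function.update_of_ne hl, hother (v - Pi.single i (2 ^ j i)) l hl (by simp [hl])]

theorem HasDegree.transAt (i : Fin d) {f g : Ω^ (Fin d) (Sph d) (north d)} {a b : ℤ}
    (hf : HasDegree f a) (hg : HasDegree g b) : HasDegree (GenLoop.transAt i f g) (a + b) := by
  obtain ⟨i1, h1⟩ := hf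
  obtain ⟨i2, h2⟩ := hg
  refine ⟨max i1 i2 + 1, fun j' hj' => ?_⟩
  obtain ⟨j, rfl⟩ : ∃ j, j' = Function.update j i (j i + 1) := by
    refine ⟨Function.update j' i (j' i - 1), ?_⟩
    have := hj' i
    rw [Function.update_idem, Function.update_self, Nat.sub_add_cancel (by omega),
      Function.update_eq_self]
  have hj : ∀ l, max i1 i2 ≤ j l := fun l => by
    have := hj' l
    by_cases hl : l = i
    · subst hl; rw [Function.update_self] at this; omega
    · rw [Function.update_of_ne hl] at this; omega
  have hfb := f.2
  have hgb := g.2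
  set w : Fin d → ℤ := -Pi.single i (2 ^ j i) with hw
  have hwi : w i = - 2 ^ j i := by simp [hw]
  have hu : ∀ k (v : Fin d → ℤ), labels g j k (v + w) ≠ 0 → 2 ^ j i < v i := fun k v h => by
    have := (labels_ne_zero hgb h i).1
    rw [Pi.add_apply, hwi] at this
    linarith
  have hs : ∀ k (v : Fin d → ℤ), labels f j k v ≠ 0 → v i < 2 ^ j i := fun k v h =>
    (labels_ne_zero hfb h i).2
  have hunit : ∀ k, (unit k : Fin d → ℤ) i = 0 ∨ (unit k : Fin d → ℤ) i = 1 := fun k => by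
    by_cases hk : i = k <;> simp [unit, hk]
  have hsum : labels (GenLoop.transAt i f g) (Function.update j i (j i + 1)) =
      labels f j + fun k v => labels g j k (v + w) := by
    funext k v
    have := transAt_grid i f g j v
    rw [Pi.add_apply, Pi.add_apply]
    split_ifs at this with hv
    · rw [labels_eq_of_eq this k, left_eq_add]
      by_contra h
      exact absurd (hu k v h) (not_lt.2 hv)
    · rw [labels_eq_of_eq this k, hw, ← sub_eq_add_neg, right_eq_add]
      by_contra h
      exact hv (hs k v h).le
  have hd : d ≠ 0 := fun h => by subst h; exact i.elim0
  rw [hsum, count_add hd, count_shift, h1 j fun l => (le_max_left _ _).trans (hj l),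
    h2 j fun l => (le_max_right _ _).trans (hj l), add_smul]
  · exact support_labels_finite hfb j 0
  · exact (support_labels_finite hgb j 0).preimage (add_left_injective w).injOn
  · intro k k' v
    by_contra h
    have h3 := hs k v (left_ne_zero_of_mul h)
    have h4 := hu k' v (right_ne_zero_of_mul h)
    omega
  · intro k k' v l
    by_contra h
    have h3 := hs k v (left_ne_zero_of_mul h)
    have h4 := hu k' _ (right_ne_zero_of_mul h)
    rw [Pi.add_apply] at h4
    have := hunit l
    omega
  · intro k k' v l
    by_contra h
    have h3 := hs k' _ (right_ne_zero_of_mul h)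
    have h4 := hu k _ (left_ne_zero_of_mul h)
    rw [Pi.add_apply] at h3
    have := hunit l
    omega

theorem hasDegree_one {f : (I^ Fin d) → Sph d}
    (h0 : ∀ y, (f y).1 0 < 0 ↔ ∀ l, |(y l : ℝ) - 1 / 2| < 1 / 4)
    (h1 : ∀ y, (∀ l, |(y l : ℝ) - 1 / 2| < 1 / 2) → ∀ i : Fin d,
      0 < (f y).1 i.succ ↔ 1 / 2 < (y i : ℝ)) : HasDegree f 1 := by
  refine ⟨4 * d + 1, fun j hj => ?_⟩
  have hj4 : ∀ l, (4 * d : ℝ) < 2 ^ j l := fun l => by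
    have h2 : 4 * d < 2 ^ j l := (by omega : 4 * d < 4 * d + 1).trans_le
      ((hj l).trans Nat.lt_two_pow_self.le)
    exact_mod_cast h2
  have hc : ∀ l, (2 : ℝ) ^ (j l - 1) = 2 ^ j l / 2 := fun l => by
    rw [eq_div_iff two_ne_zero, ← pow_succ, Nat.sub_add_cancel ((by omega : 1 ≤ 4 * d + 1).trans (hj l))]
  have hpos : ∀ l, (0 : ℝ) < 2 ^ j l := fun l => by positivity
  rw [one_smul]
  refine count_eq_vol (fun l => 2 ^ (j l - 1)) _ ?_ fun v hv w hw i => ?_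
  · rw [labels_zero, if_pos]
    rw [h0]
    intro l
    rw [grid]
    push_cast
    rw [hc, div_div_cancel_left' (hpos l).ne']
    norm_num [Set.coe_projIcc]
  · rw [labels_zero] at hv
    have hv0 := (h0 _).1 (of_not_not fun h => hv (if_neg h))
    have hgrid : ∀ l, |(v l : ℝ) / 2 ^ j l - 1 / 2| < 1 / 4 := fun l => by
      have := hv0 l
      rw [grid, Set.coe_projIcc, abs_lt] at this
      rw [abs_lt]
      constructor
      · by_contra! h
        have h3 : (v l : ℝ) / 2 ^ j l ≤ 1 / 4 := by linarith
        rw [min_eq_right (by linarith)] at this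
        have := this.1
        rcases max_cases 0 ((v l : ℝ) / 2 ^ j l) with h4 | h4 <;> linarith
      · by_contra! h
        have := this.2
        have h4 := le_max_right 0 (min 1 ((v l : ℝ) / 2 ^ j l))
        rcases min_cases 1 ((v l : ℝ) / 2 ^ j l) with h5 | h5 <;> linarith
    have hw' : ∀ l, |(w l : ℝ) / 2 ^ j l - 1 / 2| < 1 / 2 := fun l => by
      have h3 := abs_lt.1 (hgrid l)
      have h4 : (v l : ℝ) / 2 ^ j l ≤ (w l : ℝ) / 2 ^ j l :=
        div_le_div_of_nonneg_right (by exact_mod_cast (hw l).1) (hpos l).le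
      have h5 : (w l : ℝ) / 2 ^ j l ≤ (v l : ℝ) / 2 ^ j l + 1 / 4 := by
        have : (w l : ℝ) / 2 ^ j l ≤ ((v l : ℝ) + d) / 2 ^ j l :=
          div_le_div_of_nonneg_right (by exact_mod_cast (hw l).2) (hpos l).le
        rw [add_div] at this
        have h6 : (d : ℝ) / 2 ^ j l ≤ 1 / 4 := by
          rw [div_le_iff₀ (hpos l)]; linarith [hj4 l]
        linarith
      rw [abs_lt]
      constructor <;> linarith [h3.1, h3.2]
    have hproj : ∀ l, ((grid j w l : I) : ℝ) = (w l : ℝ) / 2 ^ j l := fun l => by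
      have h3 := abs_lt.1 (hw' l)
      rw [grid, Set.coe_projIcc, min_eq_right (by linarith), max_eq_right (by linarith)]
    rw [labels_succ]
    refine if_congr ?_ rfl rfl
    rw [h1 _ fun l => by rw [hproj]; exact hw' l, hproj, lt_div_iff₀ (hpos i), ← Int.cast_lt (R := ℝ)]
    push_cast
    rw [hc]
    constructor <;> intro h <;> linarith

/-- The radial projection onto the unit sphere (with a junk value at the origin). -/
noncomputable def radial (v : EuclideanSpace ℝ (Fin (d + 1))) : Sph d :=
  if h : v = 0 then north d else
    ⟨‖v‖⁻¹ • v, by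
      rw [mem_sphere_zero_iff_norm, norm_smul, norm_inv, norm_norm,
        inv_mul_cancel₀ (norm_ne_zero_iff.2 h)]⟩

theorem coe_radial {v : EuclideanSpace ℝ (Fin (d + 1))} (h : v ≠ 0) :
    (radial v).1 = ‖v‖⁻¹ • v := by
  rw [radial, dif_neg h]

theorem radial_coe (x : Sph d) : radial x.1 = x := by
  have h : x.1 ≠ 0 := fun h => by
    have := mem_sphere_zero_iff_norm.1 x.2
    rw [h, norm_zero] at this
    exact zero_ne_one this
  refine Subtype.ext ?_
  rw [coe_radial h, mem_sphere_zero_iff_norm.1 x.2, inv_one, one_smul]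

theorem continuous_radial {X : Type*} [TopologicalSpace X]
    {v : X → EuclideanSpace ℝ (Fin (d + 1))} (hv : Continuous v) (h : ∀ x, v x ≠ 0) :
    Continuous fun x => radial (v x) := by
  refine continuous_induced_rng.2 ?_
  have : (Subtype.val ∘ fun x => radial (v x)) = fun x => ‖v x‖⁻¹ • v x :=
    funext fun x => coe_radial (h x)
  rw [this]
  exact (hv.norm.inv₀ fun x => norm_ne_zero_iff.2 (h x)).smul hv

/-- The vector with first coordinate `a` and remaining coordinates `b`. -/
noncomputable def vec (a : ℝ) (b : Fin d → ℝ) : EuclideanSpace ℝ (Fin (d + 1)) :=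
  WithLp.toLp 2 (Fin.cons a b)

theorem vec_zero (a : ℝ) (b : Fin d → ℝ) : vec a b 0 = a := rfl

theorem vec_succ (a : ℝ) (b : Fin d → ℝ) (i : Fin d) : vec a b i.succ = b i := rfl

theorem vec_ne_zero {a : ℝ} {b : Fin d → ℝ} (h : a = 0 → b ≠ 0) : vec a b ≠ 0 := by
  intro h0
  refine h ?_ (funext fun i => ?_)
  · rw [← vec_zero a b, h0]; rfl
  · rw [← vec_succ a b, h0]; rfl

theorem vec_eta (v : EuclideanSpace ℝ (Fin (d + 1))) : vec (v 0) (fun i => v i.succ) = v := by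
  ext i
  induction i using Fin.cases with
  | zero => rfl
  | succ i => rfl

theorem continuous_vec {X : Type*} [TopologicalSpace X] {a : X → ℝ} {b : X → Fin d → ℝ}
    (ha : Continuous a) (hb : Continuous b) : Continuous fun x => vec (a x) (b x) := by
  refine (PiLp.continuous_toLp 2 _).comp (continuous_pi fun i => ?_)
  induction i using Fin.cases with
  | zero => exact ha
  | succ i => exact (continuous_apply i).comp hb

theorem radial_vec_zero {a : ℝ} (ha : 0 < a) : radial (vec a (0 : Fin d → ℝ)) = north d := by
  have h : vec a (0 : Fin d → ℝ) = a • (north d).1 := by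
    ext i
    induction i using Fin.cases with
    | zero => simp [vec_zero, north_zero]
    | succ i => simp [vec_succ, north_succ]
  have h1 : vec a (0 : Fin d → ℝ) ≠ 0 := vec_ne_zero fun h => absurd h ha.ne'
  refine Subtype.ext ?_
  rw [coe_radial h1, h, norm_smul, mem_sphere_zero_iff_norm.1 (north d).2, mul_one,
    Real.norm_of_nonneg ha.le, smul_smul, inv_mul_cancel₀ ha.ne', one_smul]

theorem homotopic_of_family {F G : Ω^ (Fin d) (Sph d) (north d)}
    (v : I × (I^ Fin d) → EuclideanSpace ℝ (Fin (d + 1))) (hv : Continuous v) (h : ∀ p, v p ≠ 0)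
    (h0 : ∀ y, radial (v (0, y)) = F y) (h1 : ∀ y, radial (v (1, y)) = G y)
    (hb : ∀ t, ∀ y ∈ Cube.boundary (Fin d), radial (v (t, y)) = north d) :
    GenLoop.Homotopic F G :=
  ⟨{ toFun := fun p => radial (v p)
     continuous_toFun := continuous_radial hv h
     map_zero_left := h0
     map_one_left := h1
     prop' := fun t y hy => (hb t y hy).trans (F.2 y hy).symm }⟩

/-- Data presenting a loop in the sphere: the direction `(a, max (1 - a) 0 • h)`. -/
structure Data (d : ℕ) where
  /-- the height function -/
  a : (I^ Fin d) → ℝ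
  /-- the equatorial part -/
  h : (I^ Fin d) → Fin d → ℝ
  continuous_a : Continuous a
  continuous_h : Continuous h
  ne_zero : ∀ y, a y = 0 → h y ≠ 0
  one_le : ∀ y ∈ Cube.boundary (Fin d), 1 ≤ a y

/-- The vector underlying a point of a presented loop. -/
noncomputable def dir (a : ℝ) (h : Fin d → ℝ) : EuclideanSpace ℝ (Fin (d + 1)) :=
  vec a (max (1 - a) 0 • h)

theorem dir_ne_zero {a : ℝ} {h : Fin d → ℝ} (H : a = 0 → h ≠ 0) : dir a h ≠ 0 :=
  vec_ne_zero fun ha => by simpa [ha] using H ha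

theorem radial_dir {a : ℝ} (ha : 1 ≤ a) (h : Fin d → ℝ) : radial (dir a h) = north d := by
  rw [dir, max_eq_right (by linarith), zero_smul, radial_vec_zero (by linarith)]

theorem continuous_dir {X : Type*} [TopologicalSpace X] {a : X → ℝ} {h : X → Fin d → ℝ}
    (ha : Continuous a) (hh : Continuous h) : Continuous fun x => dir (a x) (h x) :=
  continuous_vec ha (((continuous_const.sub ha).max continuous_const).smul hh)

namespace Data

/-- The loop presented by the data. -/
noncomputable def loop (A : Data d) : Ω^ (Fin d) (Sph d) (north d) :=
  ⟨⟨fun y => radial (dir (A.a y) (A.h y)), continuous_radial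
    (continuous_dir A.continuous_a A.continuous_h) fun y => dir_ne_zero (A.ne_zero y)⟩,
    fun y hy => radial_dir (A.one_le y hy) _⟩

theorem loop_apply (A : Data d) (y : I^ Fin d) : A.loop y = radial (dir (A.a y) (A.h y)) := rfl

theorem homotopic_of_family {A B : Data d} (a : I × (I^ Fin d) → ℝ) (h : I × (I^ Fin d) → Fin d → ℝ)
    (ha : Continuous a) (hh : Continuous h) (hne : ∀ p, a p = 0 → h p ≠ 0)
    (hb : ∀ t, ∀ y ∈ Cube.boundary (Fin d), 1 ≤ a (t, y))
    (ha0 : ∀ y, a (0, y) = A.a y) (ha1 : ∀ y, a (1, y) = B.a y)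
    (hh0 : ∀ y, h (0, y) = A.h y) (hh1 : ∀ y, h (1, y) = B.h y) :
    GenLoop.Homotopic A.loop B.loop :=
  SphereDegree.homotopic_of_family (fun p => dir (a p) (h p)) (continuous_dir ha hh)
    (fun p => dir_ne_zero (hne p)) (fun y => by rw [ha0, hh0, loop_apply])
    (fun y => by rw [ha1, hh1, loop_apply]) fun t y hy => radial_dir (hb t y hy) _

theorem homotopic_of_h_eq {A B : Data d} (hh : A.h = B.h)
    (h : ∀ y, A.h y = 0 → 0 < A.a y * B.a y) : GenLoop.Homotopic A.loop B.loop := by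
  refine homotopic_of_family (fun p => (1 - (p.1 : ℝ)) * A.a p.2 + p.1 * B.a p.2)
    (fun p => A.h p.2) ?_ (A.continuous_h.comp continuous_snd) ?_ ?_ (by simp) (by simp) (by simp)
    (by simp [hh])
  · have h1 := A.continuous_a
    have h2 := B.continuous_a
    fun_prop
  · rintro ⟨t, y⟩ h0 h1
    have h2 := h y h1
    have ht0 := t.2.1
    have ht1 := t.2.2
    simp only at h0
    rcases pos_and_pos_or_neg_and_neg_of_mul_pos h2 with ⟨h3, h4⟩ | ⟨h3, h4⟩
    · nlinarith [mul_nonneg ht0 h4.le, mul_nonneg (sub_nonneg.2 ht1) h3.le]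
    · nlinarith [mul_nonneg ht0 (neg_pos.2 h4).le, mul_nonneg (sub_nonneg.2 ht1) (neg_pos.2 h3).le]
  · intro t y hy
    have h1 := A.one_le y hy
    have h2 := B.one_le y hy
    have ht0 := t.2.1
    have ht1 := t.2.2
    simp only
    nlinarith [mul_nonneg ht0 (sub_nonneg.2 h2), mul_nonneg (sub_nonneg.2 ht1) (sub_nonneg.2 h1)]

theorem homotopic_of_a_eq {A B : Data d} (ha : A.a = B.a)
    (h : ∀ y, A.a y = 0 → ∀ t : ℝ, 0 ≤ t → t ≤ 1 → (1 - t) • A.h y + t • B.h y ≠ 0) :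
    GenLoop.Homotopic A.loop B.loop := by
  refine homotopic_of_family (fun p => A.a p.2)
    (fun p => (1 - (p.1 : ℝ)) • A.h p.2 + (p.1 : ℝ) • B.h p.2) (A.continuous_a.comp continuous_snd)
    ?_ (fun p hp => h p.2 hp p.1 p.1.2.1 p.1.2.2) (fun t y hy => A.one_le y hy) (by simp)
    (by simp [ha]) (by simp) (by simp)
  have h1 := A.continuous_h
  have h2 := B.continuous_h
  fun_prop

theorem exists_homotopic (f : Ω^ (Fin d) (Sph d) (north d)) :
    ∃ A : Data d, GenLoop.Homotopic f A.loop := by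
  have hf : Continuous fun y => (f y).1 := continuous_subtype_val.comp f.1.continuous
  have hc : ∀ i, Continuous fun y => (f y).1 i := fun i =>
    (continuous_apply i).comp ((PiLp.continuous_ofLp 2 _).comp hf)
  have ht : Continuous fun y => fun i : Fin d => (f y).1 i.succ := continuous_pi fun i => hc _
  have hne : ∀ y, (f y).1 0 = 0 → (fun i : Fin d => (f y).1 i.succ) ≠ 0 := fun y h0 h1 => by
    have h2 := mem_sphere_zero_iff_norm.1 (f y).2
    rw [← vec_eta (f y).1, h0, h1] at h2
    have h3 : vec 0 (0 : Fin d → ℝ) = 0 := by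
      ext i
      induction i using Fin.cases with
      | zero => rfl
      | succ i => rfl
    rw [h3, norm_zero] at h2
    exact zero_ne_one h2
  have hle : ∀ y, (f y).1 0 ≤ 1 := fun y => by
    have := PiLp.norm_apply_le (f y).1 0
    rw [mem_sphere_zero_iff_norm.1 (f y).2] at this
    exact (le_abs_self _).trans this
  refine ⟨⟨fun y => (f y).1 0, fun y i => (f y).1 i.succ, hc 0, ht, hne,
    fun y hy => by rw [GenLoop.boundary f y hy, north_zero]⟩, ?_⟩
  refine SphereDegree.homotopic_of_family (fun p => vec ((f p.2).1 0)
    ((1 - (p.1 : ℝ) * (f p.2).1 0) • fun i : Fin d => (f p.2).1 i.succ)) ?_ ?_ ?_ ?_ ?_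
  · have h2 : Continuous fun p : I × (I^ Fin d) => 1 - (p.1 : ℝ) * (f p.2).1 0 := by
      have := hc 0
      fun_prop
    have h3 : Continuous fun p : I × (I^ Fin d) => fun i : Fin d => (f p.2).1 i.succ :=
      ht.comp continuous_snd
    exact continuous_vec ((hc 0).comp continuous_snd) (h2.smul h3)
  · rintro ⟨t, y⟩
    refine vec_ne_zero fun h0 => ?_
    simp only at h0
    simpa [h0] using hne y h0
  · intro y
    simp [vec_eta, radial_coe]
  · intro y
    rw [loop_apply, dir, max_eq_left (sub_nonneg.2 (hle y))]
    simp
  · intro t y hy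
    have h1 : (fun i : Fin d => (north d).1 i.succ) = 0 := funext north_succ
    simp only [GenLoop.boundary f y hy, north_zero, h1]
    rw [smul_zero, radial_vec_zero one_pos]

end Data

/-- Reparametrising one coordinate of a loop does not change its homotopy class. -/
theorem homotopic_of_reparam {X : Type*} [TopologicalSpace X] {x : X} {N : Type*} [DecidableEq N]
    {F G : Ω^ N X x} (i : N) (ρ : C(I, I)) (h0 : ρ 0 = 0) (h1 : ρ 1 = 1)
    (h : ∀ y, G y = F (Function.update y i (ρ (y i)))) : GenLoop.Homotopic F G := by
  have hmem : ∀ (t s s' : I), (1 - (t : ℝ)) * s + t * s' ∈ I := fun t s s' =>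
    convex_Icc 0 1 s.2 s'.2 (sub_nonneg.2 t.2.2) t.2.1 (by ring)
  have key : ∀ t : I, ∀ y ∈ Cube.boundary N,
      F (Function.update y i ⟨_, hmem t (y i) (ρ (y i))⟩) = x := by
    rintro t y ⟨j, hj⟩
    refine F.2 _ ⟨j, ?_⟩
    by_cases hji : j = i
    · subst hji
      rw [Function.update_self]
      rcases hj with hj | hj
      · left; ext; simp [hj, h0]
      · right; ext; simp [hj, h1]
    · rwa [Function.update_of_ne hji]
  refine ⟨{ toFun := fun p => F (Function.update p.2 i ⟨_, hmem p.1 (p.2 i) (ρ (p.2 i))⟩)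
            continuous_toFun := ?_
            map_zero_left := fun y => ?_
            map_one_left := fun y => ?_
            prop' := fun t y hy => (key t y hy).trans (F.2 y hy).symm }⟩
  · refine F.1.continuous.comp (continuous_snd.update i (Continuous.subtype_mk ?_ _))
    fun_prop
  · simp
  · simp [h]

/-- A loop which is constant on an interior slice `yᵢ = c` of the cube is the concatenation of its
restrictions to both sides of the slice. -/
theorem homotopic_transAt {X : Type*} [TopologicalSpace X] {x : X} {N : Type*} [DecidableEq N]
    {F L R : Ω^ N X x} (i : N) (c : I)
    (hL : ∀ y, L y = F (Function.update y i (min (y i) c)))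
    (hR : ∀ y, R y = F (Function.update y i (max (y i) c))) :
    GenLoop.Homotopic F (GenLoop.transAt i L R) := by
  have hc0 := c.2.1
  have hc1 := c.2.2
  have hmem : ∀ s : I, max (min (2 * (s : ℝ)) c) (2 * s - 1) ∈ I := fun s => by
    have := s.2.1
    have := s.2.2
    constructor <;> grind
  refine homotopic_of_reparam i ⟨fun s => ⟨_, hmem s⟩, by fun_prop⟩ ?_ ?_ fun y => ?_
  · ext; simp [hc0]
  · ext; norm_num [hc1]
  · have h0 : GenLoop.transAt i L R y = _ := congrFun (GenLoop.coe_copy _ _) _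
    rw [h0]
    have hy0 := (y i).2.1
    have hy1 := (y i).2.2
    split_ifs with h
    · rw [hL, Function.update_idem]
      refine congrArg F (congrArg (Function.update y i) (Subtype.ext ?_))
      simp only [Function.update_self, ContinuousMap.coe_mk]
      rw [Monotone.map_min (f := (Subtype.val : I → ℝ)) fun _ _ h => h]
      simp only [Set.coe_projIcc]
      grind
    · rw [hR, Function.update_idem]
      refine congrArg F (congrArg (Function.update y i) (Subtype.ext ?_))
      simp only [Function.update_self, ContinuousMap.coe_mk]
      rw [Monotone.map_max (f := (Subtype.val : I → ℝ)) fun _ _ h => h]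
      simp only [Set.coe_projIcc]
      grind

/-- The class of a loop in the homotopy group. -/
noncomputable def cls (f : Ω^ (Fin d) (Sph d) (north d)) : HomotopyGroup (Fin d) (Sph d) (north d) :=
  Quotient.mk _ f

theorem cls_congr {f g : Ω^ (Fin d) (Sph d) (north d)} (h : GenLoop.Homotopic f g) :
    cls f = cls g :=
  Quotient.sound h

theorem cls_transAt [Nonempty (Fin d)] (i : Fin d) (f g : Ω^ (Fin d) (Sph d) (north d)) :
    cls (GenLoop.transAt i f g) = cls g * cls f :=
  HomotopyGroup.mul_spec.symm

theorem cls_symmAt [Nonempty (Fin d)] (i : Fin d) (f : Ω^ (Fin d) (Sph d) (north d)) :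
    cls (GenLoop.symmAt i f) = (cls f)⁻¹ :=
  HomotopyGroup.inv_spec.symm

theorem cls_const [Nonempty (Fin d)] :
    cls (GenLoop.const : Ω^ (Fin d) (Sph d) (north d)) = 1 :=
  HomotopyGroup.one_def.symm

namespace Data

/-- Restricting a presented loop to one side of a slice on which it is constant. -/
theorem exists_restrict {B : Data d} {i : Fin d} {c : I} (hc : ∀ y, y i = c → 1 ≤ B.a y)
    (ρ : C(I, I)) (hρ : ∀ s, ρ s = s ∨ ρ s = c) :
    ∃ (L : Ω^ (Fin d) (Sph d) (north d)) (A : Data d),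
      (∀ y, L y = B.loop (Function.update y i (ρ (y i)))) ∧ GenLoop.Homotopic L A.loop ∧
      A.h = B.h ∧ ∀ y, A.a y ≤ 0 → ρ (y i) = y i ∧ B.a y ≤ 0 := by
  have hcont : Continuous fun y : I^ Fin d => Function.update y i (ρ (y i)) :=
    continuous_id.update i (ρ.continuous.comp (continuous_apply i))
  have hfix : ∀ y : I^ Fin d, ρ (y i) = y i → Function.update y i (ρ (y i)) = y := fun y h => by
    rw [h, Function.update_eq_self]
  have hle : ∀ y : I^ Fin d, ρ (y i) ≠ y i → 1 ≤ B.a (Function.update y i (ρ (y i))) :=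
    fun y h => hc _ (by rw [Function.update_self]; exact (hρ _).resolve_left h)
  have hone : ∀ y ∈ Cube.boundary (Fin d), 1 ≤ B.a (Function.update y i (ρ (y i))) := by
    intro y hy
    by_cases h : ρ (y i) = y i
    · rw [hfix y h]
      exact B.one_le y hy
    · exact hle y h
  have hne : ∀ y : I^ Fin d, B.a (Function.update y i (ρ (y i))) ≤ 0 → ρ (y i) = y i := by
    intro y h0
    by_contra h
    linarith [hle y h]
  let A₁ : Data d :=
    ⟨fun y => B.a (Function.update y i (ρ (y i))), fun y => B.h (Function.update y i (ρ (y i))),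
      B.continuous_a.comp hcont, B.continuous_h.comp hcont, fun y => B.ne_zero _, hone⟩
  let A₂ : Data d :=
    ⟨fun y => B.a (Function.update y i (ρ (y i))), B.h,
      B.continuous_a.comp hcont, B.continuous_h, fun y h => by
        rw [hfix y (hne y h.le)] at h
        exact B.ne_zero y h, hone⟩
  refine ⟨A₁.loop, A₂, fun y => rfl, homotopic_of_a_eq rfl fun y hy t _ _ => ?_, rfl,
    fun y hy => ⟨hne y hy, ?_⟩⟩
  · have h1 : B.a (Function.update y i (ρ (y i))) = 0 := hy
    have h2 := hfix y (hne y h1.le)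
    have h3 : A₁.h y = B.h y := congrArg B.h h2
    have h4 : A₂.h y = B.h y := rfl
    rw [h3, h4, ← add_smul, sub_add_cancel, one_smul]
    rw [h2] at h1
    exact B.ne_zero y h1
  · have h1 : B.a (Function.update y i (ρ (y i))) ≤ 0 := hy
    rwa [hfix y (hne y hy)] at h1

theorem cls_loop_eq_one [Nonempty (Fin d)] {A : Data d} (h : ∀ y, A.h y = 0 → 0 < A.a y) :
    cls A.loop = 1 := by
  let B : Data d := ⟨fun _ => 1, A.h, continuous_const, A.continuous_h,
    fun _ h => absurd h one_ne_zero, fun _ _ => le_rfl⟩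
  have h1 : GenLoop.Homotopic A.loop B.loop := homotopic_of_h_eq rfl fun y hy => by
    simpa [B] using h y hy
  rw [cls_congr h1, ← cls_const]
  congr 1
  ext1 y
  exact radial_dir le_rfl _

/-- A presented loop with finitely many preimages of the south pole is a product of presented loops
with at most one preimage of the south pole. -/
theorem cls_loop_mem_of_finite [Nonempty (Fin d)]
    (H : Subgroup (HomotopyGroup (Fin d) (Sph d) (north d))) (h : (I^ Fin d) → Fin d → ℝ)
    (hs : ∀ A : Data d, A.h = h → ∀ z, {y | A.a y ≤ 0 ∧ h y = 0} = {z} → cls A.loop ∈ H)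
    (A : Data d) (hA : A.h = h) (hZ : {y | A.a y ≤ 0 ∧ h y = 0}.Finite) : cls A.loop ∈ H := by
  induction hk : {y | A.a y ≤ 0 ∧ h y = 0}.ncard using Nat.strong_induction_on generalizing A with
  | _ k ih =>
  subst hk
  set Z := {y | A.a y ≤ 0 ∧ h y = 0} with hZdef
  rcases Z.eq_empty_or_nonempty with h0 | ⟨w, hw⟩
  · rw [cls_loop_eq_one fun y hy => ?_]
    · exact H.one_mem
    · by_contra! h1
      have : y ∈ Z := ⟨h1, hA ▸ hy⟩
      rw [h0] at this
      exact this
  by_cases hw1 : Z = {w}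
  · exact hs A hA w hw1
  obtain ⟨z, hz, z', hz', i, hi⟩ : ∃ z ∈ Z, ∃ z' ∈ Z, ∃ i, z i < z' i := by
    obtain ⟨w', hw', hne⟩ : ∃ w' ∈ Z, w' ≠ w := by
      by_contra! h1
      exact hw1 (Set.eq_singleton_iff_unique_mem.2 ⟨hw, h1⟩)
    obtain ⟨i, hi⟩ := Function.ne_iff.1 hne
    rcases lt_or_gt_of_ne hi with hi | hi
    · exact ⟨w', hw', w, hw, i, hi⟩
    · exact ⟨w, hw, w', hw', i, hi⟩
  obtain ⟨c, hc, hcZ⟩ := (Set.Ioo_infinite hi).exists_notMem_finite (hZ.image fun y => y i)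
  have hcne : ∀ y ∈ Z, 0 < |(y i : ℝ) - c| := fun y hy => abs_pos.2 (sub_ne_zero.2 fun h =>
    hcZ ⟨y, hy, Subtype.ext h⟩)
  obtain ⟨M, hM⟩ := (hZ.image fun y => 2 / |(y i : ℝ) - c|).bddAbove
  have hM' : ∀ y ∈ Z, 1 - M * |(y i : ℝ) - c| < 0 := fun y hy => by
    have := hM ⟨y, hy, rfl⟩
    simp only at this
    rw [div_le_iff₀ (hcne y hy)] at this
    linarith
  have hneg : ∀ y ∈ Z, A.a y < 0 := fun y hy => lt_of_le_of_ne hy.1 fun h1 =>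
    A.ne_zero y h1 (hA ▸ hy.2)
  let B : Data d := ⟨fun y => max (A.a y) (1 - M * |(y i : ℝ) - c|), h, by
      have := A.continuous_a
      fun_prop, hA ▸ A.continuous_h, fun y h0 h1 => by
      have hy : y ∈ Z := ⟨(le_max_left _ _).trans h0.le, h1⟩
      exact absurd h0 (max_lt (hneg y hy) (hM' y hy)).ne,
    fun y hy => le_max_of_le_left (A.one_le y hy)⟩
  have hBa : ∀ y, B.a y = max (A.a y) (1 - M * |(y i : ℝ) - c|) := fun _ => rfl
  have hAB : GenLoop.Homotopic A.loop B.loop := homotopic_of_h_eq hA fun y hy => by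
    rcases le_or_gt (A.a y) 0 with h1 | h1
    · have hyZ : y ∈ Z := ⟨h1, hA ▸ hy⟩
      exact mul_pos_of_neg_of_neg (hneg y hyZ) (max_lt (hneg y hyZ) (hM' y hyZ))
    · exact mul_pos h1 (lt_max_of_lt_left h1)
  have hBc : ∀ y, y i = c → 1 ≤ B.a y := fun y hy => le_max_of_le_right (by simp [hy])
  obtain ⟨L, A₁, hL, hLA, hA₁, hA₁'⟩ := exists_restrict hBc ⟨fun s => min s c, by fun_prop⟩
    fun s => min_choice s c
  obtain ⟨R, A₂, hR, hRA, hA₂, hA₂'⟩ := exists_restrict hBc ⟨fun s => max s c, by fun_prop⟩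
    fun s => max_choice s c
  have hsub : ∀ A' : Data d, (∀ y, A'.a y ≤ 0 → B.a y ≤ 0) → {y | A'.a y ≤ 0 ∧ h y = 0} ⊆ Z :=
    fun A' h1 y hy => ⟨(le_max_left _ _).trans (h1 y hy.1), hy.2⟩
  rw [cls_congr hAB, cls_congr (homotopic_transAt i c hL hR), cls_transAt, cls_congr hLA,
    cls_congr hRA]
  have s₁ := hsub A₁ fun y hy => (hA₁' y hy).2
  have s₂ := hsub A₂ fun y hy => (hA₂' y hy).2
  refine H.mul_mem (ih _ (Set.ncard_lt_ncard ⟨s₂, fun h1 => ?_⟩ hZ) A₂ hA₂ (hZ.subset s₂) rfl)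
    (ih _ (Set.ncard_lt_ncard ⟨s₁, fun h1 => ?_⟩ hZ) A₁ hA₁ (hZ.subset s₁) rfl)
  · exact absurd (hA₂' z (h1 hz).1).1 fun h2 => hc.1.ne' ((max_eq_right hc.1.le).symm.trans h2)
  · exact absurd (hA₁' z' (h1 hz').1).1 fun h2 => hc.2.ne ((min_eq_right hc.2.le).symm.trans h2)

end Data

/-- The inclusion of the cube into Euclidean space. -/
def emb (y : I^ Fin d) : Fin d → ℝ := fun i => y i

theorem continuous_emb : Continuous (emb : (I^ Fin d) → Fin d → ℝ) :=
  continuous_pi fun i => continuous_subtype_val.comp (continuous_apply i)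

theorem emb_injective : Function.Injective (emb : (I^ Fin d) → Fin d → ℝ) := fun _ _ h =>
  funext fun i => Subtype.ext (congrFun h i)

theorem le_norm_emb_sub {z : Fin d → ℝ} {r : ℝ} (hz : ∀ l, r ≤ z l ∧ z l ≤ 1 - r) {y : I^ Fin d}
    (hy : y ∈ Cube.boundary (Fin d)) : r ≤ ‖emb y - z‖ := by
  obtain ⟨i, hi⟩ := hy
  refine le_trans ?_ (norm_le_pi_norm (emb y - z) i)
  have h1 := hz i
  rw [Real.norm_eq_abs, Pi.sub_apply]
  rcases hi with hi | hi
  · have : emb y i = 0 := congrArg Subtype.val hi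
    rw [this]
    exact le_trans (by linarith) (neg_le_abs _)
  · have : emb y i = 1 := congrArg Subtype.val hi
    rw [this]
    exact le_trans (by linarith) (le_abs_self _)

/-- The height function which is negative exactly on the ball of radius `r / 2` about `z`. -/
noncomputable def height (z : Fin d → ℝ) (r : ℝ) (y : I^ Fin d) : ℝ := 2 * ‖emb y - z‖ / r - 1

theorem continuous_height (z : Fin d → ℝ) (r : ℝ) : Continuous (height z r) := by
  have := continuous_emb (d := d)
  unfold height
  fun_prop

theorem one_le_height {z : Fin d → ℝ} {r : ℝ} (hr : 0 < r) (hz : ∀ l, r ≤ z l ∧ z l ≤ 1 - r)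
    {y : I^ Fin d} (hy : y ∈ Cube.boundary (Fin d)) : 1 ≤ height z r y := by
  have := le_norm_emb_sub hz hy
  rw [height, le_sub_iff_add_le, le_div_iff₀ hr]
  linarith

theorem height_eq_zero_iff {z : Fin d → ℝ} {r : ℝ} (hr : 0 < r) {y : I^ Fin d} :
    height z r y = 0 ↔ ‖emb y - z‖ = r / 2 := by
  rw [height, sub_eq_zero, div_eq_iff hr.ne']
  constructor <;> intro h <;> linarith

theorem mulVec_ne_zero {M : Matrix (Fin d) (Fin d) ℝ} (hM : M.det ≠ 0) {z : Fin d → ℝ} {r : ℝ}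
    (hr : 0 < r) {y : I^ Fin d} (hy : height z r y = 0) : M.mulVec (emb y - z) ≠ 0 := by
  intro h
  have h1 := Matrix.eq_zero_of_mulVec_eq_zero hM h
  rw [height_eq_zero_iff hr, h1, norm_zero] at hy
  linarith

/-- The presented loop wrapping a small cube about `z` linearly around the sphere. -/
noncomputable def bump (z : Fin d → ℝ) (r : ℝ) (M : Matrix (Fin d) (Fin d) ℝ) (hr : 0 < r)
    (hz : ∀ l, r ≤ z l ∧ z l ≤ 1 - r) (hM : M.det ≠ 0) : Data d where
  a := height z r
  h y := M.mulVec (emb y - z)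
  continuous_a := continuous_height z r
  continuous_h := by
    have := continuous_emb (d := d)
    exact Continuous.matrix_mulVec continuous_const (by fun_prop)
  ne_zero _ hy := mulVec_ne_zero hM hr hy
  one_le _ hy := one_le_height hr hz hy

theorem bump_homotopic {z : ℝ → Fin d → ℝ} {r : ℝ → ℝ} {M : ℝ → Matrix (Fin d) (Fin d) ℝ}
    (hzc : Continuous z) (hrc : Continuous r) (hMc : Continuous M)
    (hr : ∀ t ∈ I, 0 < r t) (hz : ∀ t ∈ I, ∀ l, r t ≤ z t l ∧ z t l ≤ 1 - r t)
    (hM : ∀ t ∈ I, (M t).det ≠ 0) {z₀ z₁ : Fin d → ℝ} {r₀ r₁ : ℝ}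
    {M₀ M₁ : Matrix (Fin d) (Fin d) ℝ} {hr₀ hz₀ hM₀ hr₁ hz₁ hM₁} (ez₀ : z 0 = z₀) (er₀ : r 0 = r₀)
    (eM₀ : M 0 = M₀) (ez₁ : z 1 = z₁) (er₁ : r 1 = r₁) (eM₁ : M 1 = M₁) :
    GenLoop.Homotopic (bump z₀ r₀ M₀ hr₀ hz₀ hM₀).loop (bump z₁ r₁ M₁ hr₁ hz₁ hM₁).loop := by
  subst ez₀ er₀ eM₀ ez₁ er₁ eM₁
  have he := continuous_emb (d := d)
  have hzc' : Continuous fun p : I × (I^ Fin d) => z p.1 :=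
    hzc.comp (continuous_subtype_val.comp continuous_fst)
  have hrc' : Continuous fun p : I × (I^ Fin d) => r p.1 :=
    hrc.comp (continuous_subtype_val.comp continuous_fst)
  have hMc' : Continuous fun p : I × (I^ Fin d) => M p.1 :=
    hMc.comp (continuous_subtype_val.comp continuous_fst)
  have hec' : Continuous fun p : I × (I^ Fin d) => emb p.2 - z p.1 :=
    (he.comp continuous_snd).sub hzc'
  refine Data.homotopic_of_family (fun p => height (z p.1) (r p.1) p.2)
    (fun p => (M p.1).mulVec (emb p.2 - z p.1)) ?_ (hMc'.matrix_mulVec hec')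
    (fun p hp => mulVec_ne_zero (hM _ p.1.2) (hr _ p.1.2) hp)
    (fun t y hy => one_le_height (hr _ t.2) (hz _ t.2) hy) (fun _ => rfl) (fun _ => rfl)
    (fun _ => rfl) (fun _ => rfl)
  unfold height
  exact ((continuous_const.mul hec'.norm).div hrc' fun p => (hr _ p.1.2).ne').sub continuous_const

theorem center_mem (l : Fin d) : (1 / 2 : ℝ) ≤ (fun _ : Fin d => (1 / 2 : ℝ)) l ∧
    (fun _ : Fin d => (1 / 2 : ℝ)) l ≤ 1 - 1 / 2 := by
  norm_num

open Classical in
/-- The class of the loop wrapping the whole cube around the sphere by an invertible matrix. -/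
noncomputable def phi [Nonempty (Fin d)] (M : Matrix (Fin d) (Fin d) ℝ) :
    HomotopyGroup (Fin d) (Sph d) (north d) :=
  if h : M.det ≠ 0 then cls (bump (fun _ => 1 / 2) (1 / 2) M (by norm_num) center_mem h).loop else 1

section

variable [Nonempty (Fin d)]

theorem phi_eq {M : Matrix (Fin d) (Fin d) ℝ} (h : M.det ≠ 0) :
    phi M = cls (bump (fun _ => 1 / 2) (1 / 2) M (by norm_num) center_mem h).loop :=
  dif_pos h

theorem phi_congr_of_path {M : ℝ → Matrix (Fin d) (Fin d) ℝ} (hMc : Continuous M)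
    (hM : ∀ t ∈ I, (M t).det ≠ 0) : phi (M 0) = phi (M 1) := by
  rw [phi_eq (hM 0 unitInterval.zero_mem), phi_eq (hM 1 unitInterval.one_mem)]
  exact cls_congr (bump_homotopic (z := fun _ _ => 1 / 2) (r := fun _ => 1 / 2)
    continuous_const continuous_const hMc (by norm_num) (fun _ _ => center_mem) hM
    rfl rfl rfl rfl rfl rfl)

theorem cls_bump {z : Fin d → ℝ} {r : ℝ} {M : Matrix (Fin d) (Fin d) ℝ} (hr : 0 < r)
    (hz : ∀ l, r ≤ z l ∧ z l ≤ 1 - r) (hM : M.det ≠ 0) :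
    cls (bump z r M hr hz hM).loop = phi M := by
  rw [phi_eq hM]
  refine cls_congr (bump_homotopic (z := fun t => (1 - t) • z + t • fun _ => 1 / 2)
    (r := fun t => (1 - t) * r + t * (1 / 2)) (M := fun _ => M) (by fun_prop) (by fun_prop)
    continuous_const (fun t ht => ?_) (fun t ht l => ?_) (fun _ _ => hM) (by simp) (by simp) rfl
    (by simp) (by simp) rfl)
  · have h0 := ht.1
    have h1 := ht.2
    rcases h0.eq_or_lt with h | h
    · simpa [← h] using hr
    · have := mul_nonneg (sub_nonneg.2 h1) hr.le
      linarith
  · have h0 := ht.1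
    have h1 := sub_nonneg.2 ht.2
    have h2 := mul_le_mul_of_nonneg_left (hz l).1 h1
    have h3 := mul_le_mul_of_nonneg_left (hz l).2 h1
    simp only [Pi.add_apply, Pi.smul_apply, smul_eq_mul]
    constructor <;> linarith

open Matrix in
theorem phi_mul_single {B : Matrix (Fin d) (Fin d) ℝ} (hB : B.det ≠ 0) (i : Fin d) {c : ℝ}
    (hc : c ≠ 0) :
    phi (B * diagonal (Function.update 1 i c)) = phi B ∨
      phi (B * diagonal (Function.update 1 i c)) = (phi B)⁻¹ := by
  have hdet : ∀ c : ℝ, (diagonal (Function.update (1 : Fin d → ℝ) i c)).det = c := fun c => by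
    rw [det_diagonal, Finset.prod_update_of_mem (Finset.mem_univ i)]
    simp
  have hpath : ∀ c c' : ℝ, 0 < c * c' → phi (B * diagonal (Function.update 1 i c)) =
      phi (B * diagonal (Function.update 1 i c')) := by
    intro c c' hcc
    have := phi_congr_of_path
      (M := fun t => B * diagonal (Function.update 1 i ((1 - t) * c + t * c'))) (by fun_prop)
      fun t ht => by
        rw [det_mul, hdet]
        refine mul_ne_zero hB ?_
        have h0 := ht.1
        have h1 := sub_nonneg.2 ht.2
        rcases pos_and_pos_or_neg_and_neg_of_mul_pos hcc with ⟨h3, h4⟩ | ⟨h3, h4⟩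
        · nlinarith [mul_nonneg h0 h4.le, mul_nonneg h1 h3.le]
        · nlinarith [mul_nonneg h0 (neg_pos.2 h4).le, mul_nonneg h1 (neg_pos.2 h3).le]
    simpa using this
  rcases lt_or_gt_of_ne hc with hc | hc
  · right
    rw [hpath c (-1) (by linarith), phi_eq hB, ← cls_symmAt i,
      phi_eq (by rw [det_mul, hdet]; simpa using hB)]
    congr 1
    ext1 y
    have h0 : GenLoop.symmAt i
      (bump (fun _ => 1 / 2) (1 / 2) B (by norm_num) center_mem hB).loop y = _ :=
      congrFun (GenLoop.coe_copy _ _) _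
    rw [h0, Data.loop_apply, Data.loop_apply]
    set y' : I^ Fin d := fun j => if j = i then unitInterval.symm (y i) else y j
    set v : Fin d → ℝ := emb y - fun _ => 1 / 2
    have hv : emb y' - (fun _ => 1 / 2) = Function.update v i (-v i) := by
      ext j
      by_cases hj : j = i
      · subst hj
        simp [v, y', emb]
        ring
      · simp [v, y', emb, hj]
    have hn : ‖Function.update v i (-v i)‖ = ‖v‖ := by
      simp only [Pi.norm_def]
      congr 2
      ext j
      by_cases hj : j = i
      · subst hj; simp
      · simp [hj]
    have hm : (B * diagonal (Function.update 1 i (-1))).mulVec v =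
        B.mulVec (Function.update v i (-v i)) := by
      rw [← mulVec_mulVec]
      congr 1
      ext j
      rw [mulVec_diagonal]
      by_cases hj : j = i
      · subst hj; simp
      · simp [hj]
    refine congrArg radial (congrArg₂ dir ?_ ?_)
    · change height _ _ _ = height _ _ _
      rw [height, height, hv, hn]
    · exact hm.trans (congrArg B.mulVec hv).symm
  · left
    rw [hpath c 1 (by linarith)]
    have h1 : Function.update (1 : Fin d → ℝ) i 1 = 1 := Function.update_eq_self i 1
    rw [h1, diagonal_one', mul_one]

open Matrix in
theorem phi_mul {B A : Matrix (Fin d) (Fin d) ℝ} (hB : B.det ≠ 0) (hA : A.det ≠ 0) :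
    phi (B * A) = phi B ∨ phi (B * A) = (phi B)⁻¹ := by
  revert B
  refine diagonal_transvection_induction_of_det_ne_zero
    (fun A => ∀ {B : Matrix (Fin d) (Fin d) ℝ}, B.det ≠ 0 →
      phi (B * A) = phi B ∨ phi (B * A) = (phi B)⁻¹) A hA ?_ ?_ ?_
  · intro D hD B hB
    rw [det_diagonal, Finset.prod_ne_zero_iff] at hD
    have hs : ∀ s : Finset (Fin d),
        (B * diagonal (fun i => if i ∈ s then D i else 1)).det ≠ 0 ∧
        (phi (B * diagonal (fun i => if i ∈ s then D i else 1)) = phi B ∨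
          phi (B * diagonal (fun i => if i ∈ s then D i else 1)) = (phi B)⁻¹) := by
      intro s
      induction s using Finset.induction_on with
      | empty => simpa using hB
      | insert i s hi ih =>
        have h1 : B * diagonal (fun j => if j ∈ insert i s then D j else 1) =
            B * diagonal (fun i => if i ∈ s then D i else 1) *
              diagonal (Function.update 1 i (D i)) := by
          rw [mul_assoc, diagonal_mul_diagonal]
          congr 2
          ext j
          by_cases hj : j = i
          · subst hj; simp [hi]
          · simp [hj]
        refine ⟨?_, ?_⟩
        · rw [det_mul, det_diagonal, Finset.prod_ite_mem, Finset.univ_inter]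
          exact mul_ne_zero hB (Finset.prod_ne_zero_iff.2 fun j _ => hD j (Finset.mem_univ j))
        · rw [h1]
          rcases phi_mul_single ih.1 i (hD i (Finset.mem_univ i)) with h2 | h2 <;>
            rcases ih.2 with h3 | h3 <;> simp [h2, h3]
    simpa using (hs Finset.univ).2
  · intro t B hB
    left
    have := phi_congr_of_path (M := fun s => B * transvection t.i t.j ((1 - s) * t.c))
      (by
        have h1 : Continuous fun s : ℝ => single t.i t.j ((1 - s) * t.c) :=
          continuous_matrix fun a b => by
            simp only [single_apply]
            split_ifs <;> fun_prop
        unfold transvection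
        fun_prop) fun s _ => by
        rw [det_mul, det_transvection_of_ne _ _ t.hij, mul_one]
        exact hB
    simpa [TransvectionStruct.toMatrix] using this
  · intro A A' hA hA' h h' B hB
    rw [← mul_assoc]
    rcases h' (B := B * A) (by rw [det_mul]; exact mul_ne_zero hB hA) with h2 | h2 <;>
      rcases h hB with h3 | h3 <;> simp [h2, h3]

theorem phi_mem {M : Matrix (Fin d) (Fin d) ℝ} (hM : M.det ≠ 0) :
    phi M ∈ Subgroup.zpowers (phi (1 : Matrix (Fin d) (Fin d) ℝ)) := by
  have h := phi_mul (B := 1) (by simp) hM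
  rw [one_mul] at h
  rcases h with h | h
  · exact h ▸ Subgroup.mem_zpowers _
  · exact h ▸ Subgroup.inv_mem _ (Subgroup.mem_zpowers _)

end

theorem exists_antilipschitzWith_of_det_ne_zero {L : (Fin d → ℝ) →L[ℝ] (Fin d → ℝ)}
    (hL : L.det ≠ 0) : ∃ C > 0, AntilipschitzWith C L := by
  refine LinearMap.exists_antilipschitzWith (L : (Fin d → ℝ) →ₗ[ℝ] (Fin d → ℝ)) ?_
  rw [← LinearMap.isUnit_iff_ker_eq_bot, LinearMap.isUnit_iff_isUnit_det]
  exact isUnit_iff_ne_zero.2 hL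

/-- A presented loop with a single nondegenerate preimage of the south pole. -/
theorem cls_loop_eq_phi [Nonempty (Fin d)] {A : Data d} {z : I^ Fin d}
    (hz : {y | A.a y ≤ 0 ∧ A.h y = 0} = {z}) {g : (Fin d → ℝ) → Fin d → ℝ}
    {L : (Fin d → ℝ) →L[ℝ] (Fin d → ℝ)} (hg : HasFDerivAt g L (emb z)) (hL : L.det ≠ 0)
    (hgh : ∀ y, A.h y = g (emb y)) :
    cls A.loop = phi (LinearMap.toMatrix' (L : (Fin d → ℝ) →ₗ[ℝ] (Fin d → ℝ))) := by
  have hzz : A.a z ≤ 0 ∧ A.h z = 0 := by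
    have : z ∈ {y | A.a y ≤ 0 ∧ A.h y = 0} := hz ▸ Set.mem_singleton z
    exact this
  have huniq : ∀ y, A.a y ≤ 0 → A.h y = 0 → y = z := fun y h1 h2 => by
    have : y ∈ {y | A.a y ≤ 0 ∧ A.h y = 0} := ⟨h1, h2⟩
    rwa [hz] at this
  have hza : A.a z < 0 := lt_of_le_of_ne hzz.1 fun h => A.ne_zero z h hzz.2
  have hzb : ∀ l, 0 < emb z l ∧ 0 < 1 - emb z l := by
    have hb : z ∉ Cube.boundary (Fin d) := fun hb => by linarith [A.one_le z hb]
    intro l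
    refine ⟨lt_of_le_of_ne (z l).2.1 fun h => hb ⟨l, Or.inl (Subtype.ext h.symm)⟩,
      sub_pos.2 (lt_of_le_of_ne (z l).2.2 fun h => hb ⟨l, Or.inr (Subtype.ext h)⟩)⟩
  obtain ⟨C, hC0, hC⟩ := exists_antilipschitzWith_of_det_ne_zero hL
  have hLle : ∀ u, ‖u‖ ≤ C * ‖L u‖ := fun u => by
    simpa [dist_eq_norm] using hC.le_mul_dist u 0
  have hC0' : (0 : ℝ) < C := hC0
  have hapx : ∀ᶠ x in 𝓝 (emb z), C * ‖g x - L (x - emb z)‖ ≤ 1 / 2 * ‖x - emb z‖ := by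
    filter_upwards [hg.isLittleO.def (c := 1 / (2 * C)) (by positivity)] with x hx
    rw [← hgh z, hzz.2, sub_zero] at hx
    calc (C : ℝ) * ‖g x - L (x - emb z)‖ ≤ C * (1 / (2 * C) * ‖x - emb z‖) := by gcongr
      _ = 1 / 2 * ‖x - emb z‖ := by field_simp
  obtain ⟨R, hR0, hR⟩ := Metric.eventually_nhds_iff.1 hapx
  obtain ⟨r, hr0, hrR, hrz⟩ : ∃ r > 0, r < R ∧ ∀ l, r ≤ emb z l ∧ r ≤ 1 - emb z l := by
    have h1 : ∀ᶠ r in 𝓝[>] (0 : ℝ), r < R := nhdsWithin_le_nhds (Iio_mem_nhds hR0)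
    have h2 : ∀ᶠ r in 𝓝[>] (0 : ℝ), ∀ l, r ≤ emb z l ∧ r ≤ 1 - emb z l :=
      Filter.eventually_all.2 fun l => nhdsWithin_le_nhds
        (Filter.inter_mem (Iic_mem_nhds (hzb l).1) (Iic_mem_nhds (hzb l).2))
    have h0 : ∀ᶠ r in 𝓝[>] (0 : ℝ), 0 < r := self_mem_nhdsWithin
    obtain ⟨r, h3, h4, h5⟩ := (h0.and (h1.and h2)).exists
    exact ⟨r, h3, h4, h5⟩
  have hrz' : ∀ l, r ≤ emb z l ∧ emb z l ≤ 1 - r := fun l =>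
    ⟨(hrz l).1, by linarith [(hrz l).2]⟩
  have hsmall : ∀ y : I^ Fin d, ‖emb y - emb z‖ ≤ r / 2 → ∀ t : ℝ, 0 ≤ t → t ≤ 1 →
      (1 - t) • A.h y + t • L (emb y - emb z) = 0 → y = z := by
    intro y hy t ht0 ht1 h0
    have h1 := hR (y := emb y) (by rw [dist_eq_norm]; linarith)
    have h2 : L (emb y - emb z) = -((1 - t) • (g (emb y) - L (emb y - emb z))) := by
      rw [← hgh, eq_neg_iff_add_eq_zero, ← h0]
      module
    have h3 := hLle (emb y - emb z)
    rw [h2, norm_neg, norm_smul, Real.norm_of_nonneg (sub_nonneg.2 ht1)] at h3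
    have h4 : C * ((1 - t) * ‖g (emb y) - L (emb y - emb z)‖) ≤
        C * ‖g (emb y) - L (emb y - emb z)‖ := by
      refine mul_le_mul_of_nonneg_left ?_ hC0'.le
      exact mul_le_of_le_one_left (norm_nonneg _) (by linarith)
    have h5 : ‖emb y - emb z‖ = 0 := le_antisymm (by linarith) (norm_nonneg _)
    exact emb_injective (sub_eq_zero.1 (norm_eq_zero.1 h5))
  set M := LinearMap.toMatrix' (L : (Fin d → ℝ) →ₗ[ℝ] (Fin d → ℝ))
  have hM : M.det ≠ 0 := by rwa [LinearMap.det_toMatrix']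
  have hMv : ∀ u, M.mulVec u = L u := fun u => LinearMap.toMatrix'_mulVec _ u
  have hne : ∀ y, height (emb z) r y = 0 → y ≠ z := by
    rintro y hy rfl
    rw [height_eq_zero_iff hr0, sub_self, norm_zero] at hy
    linarith
  let B : Data d := ⟨height (emb z) r, A.h, continuous_height _ _, A.continuous_h,
    fun y hy h0 => hne y hy (hsmall y ((height_eq_zero_iff hr0).1 hy).le 0 le_rfl zero_le_one
      (by simp [h0])), fun y hy => one_le_height hr0 hrz' hy⟩
  have hAB : GenLoop.Homotopic A.loop B.loop := by
    refine Data.homotopic_of_h_eq rfl fun y hy => ?_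
    rcases le_or_gt (A.a y) 0 with h1 | h1
    · rw [huniq y h1 hy]
      refine mul_pos_of_neg_of_neg hza ?_
      change height _ _ _ < 0
      simp [height]
    · refine mul_pos h1 ?_
      by_contra h2
      refine absurd h1 (not_lt.2 ?_)
      rw [hsmall y ?_ 0 le_rfl zero_le_one (by simp [hy])]
      · exact hza.le
      · change ¬ (0 < 2 * ‖emb y - emb z‖ / r - 1) at h2
        rw [not_lt, sub_nonpos, div_le_one hr0] at h2
        linarith
  rw [cls_congr hAB, ← cls_bump hr0 hrz' hM]
  refine cls_congr (Data.homotopic_of_a_eq rfl fun y hy t ht0 ht1 h0 => hne y hy ?_)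
  refine hsmall y ((height_eq_zero_iff hr0).1 hy).le t ht0 ht1 ?_
  rw [← h0, ← hMv]
  rfl

/-- The equatorial part of a presented loop can be made smooth with regular value `0`. -/
theorem exists_regular (A : Data d) : ∃ (B : Data d) (g : (Fin d → ℝ) → Fin d → ℝ),
    GenLoop.Homotopic A.loop B.loop ∧ Differentiable ℝ g ∧ (∀ y, B.h y = g (emb y)) ∧
      ∀ x, g x = 0 → (fderiv ℝ g x).det ≠ 0 := by
  have hK : IsCompact {y | A.a y = 0} := (isClosed_eq A.continuous_a continuous_const).isCompact
  obtain ⟨δ, hδ0, hδ⟩ := hK.exists_forall_le' A.continuous_h.norm.continuousOn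
    (a := 0) fun y hy => norm_pos_iff.2 (A.ne_zero y hy)
  have hcont : Continuous fun v : Fin d → ℝ =>
      A.h fun i => Set.projIcc (0 : ℝ) 1 zero_le_one (v i) :=
    A.continuous_h.comp (continuous_pi fun i => continuous_projIcc.comp (continuous_apply i))
  obtain ⟨g, hg, hgA, -⟩ := hcont.exists_contDiff_approx 1
    (continuous_const (y := δ / 2)) fun _ => half_pos hδ0
  have hgd : Differentiable ℝ g := hg.differentiable (by simp)
  have hgA' : ∀ y, ‖g (emb y) - A.h y‖ < δ / 2 := fun y => by
    have := hgA (emb y)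
    have h1 : (fun i => Set.projIcc (0 : ℝ) 1 zero_le_one (emb y i)) = y :=
      funext fun i => Set.projIcc_val zero_le_one (y i)
    rw [h1, dist_eq_norm] at this
    exact this
  obtain ⟨w, hw, hwg⟩ : ∃ w, ‖w‖ < δ / 2 ∧ w ∉ g '' {x | (fderiv ℝ g x).det = 0} := by
    have h0 := MeasureTheory.addHaar_image_eq_zero_of_det_fderivWithin_eq_zero
      MeasureTheory.volume (s := {x | (fderiv ℝ g x).det = 0})
      (fun x _ => (hgd x).hasFDerivAt.hasFDerivWithinAt) fun x hx => hx
    by_contra! h1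
    have h2 : MeasureTheory.volume (Metric.ball (0 : Fin d → ℝ) (δ / 2)) = 0 :=
      MeasureTheory.measure_mono_null (fun w hw => h1 w (mem_ball_zero_iff.1 hw)) h0
    exact (Metric.measure_ball_pos _ _ (half_pos hδ0)).ne' h2
  have hclose : ∀ y, ‖g (emb y) - w - A.h y‖ < δ := fun y => by
    have := norm_sub_le (g (emb y) - A.h y) w
    rw [sub_right_comm]
    linarith [hgA' y]
  have hne : ∀ y, A.a y = 0 → ∀ t : ℝ, 0 ≤ t → t ≤ 1 →
      (1 - t) • A.h y + t • (g (emb y) - w) ≠ 0 := by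
    intro y hy t ht0 ht1 h0
    have h1 : A.h y = -(t • (g (emb y) - w - A.h y)) := by
      rw [eq_neg_iff_add_eq_zero, ← h0]
      module
    have h2 := hδ y hy
    rw [h1, norm_neg, norm_smul, Real.norm_of_nonneg ht0] at h2
    have h3 := mul_le_of_le_one_left (norm_nonneg (g (emb y) - w - A.h y)) ht1
    linarith [hclose y]
  refine ⟨⟨A.a, fun y => g (emb y) - w, A.continuous_a,
    (hg.continuous.comp continuous_emb).sub continuous_const, fun y hy h0 =>
      hne y hy 1 zero_le_one le_rfl (by simp [h0]), A.one_le⟩, fun x => g x - w,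
    Data.homotopic_of_a_eq rfl hne, hgd.sub_const w, fun _ => rfl, fun x hx h0 => hwg ⟨x, ?_, ?_⟩⟩
  · rwa [fderiv_sub_const] at h0
  · exact sub_eq_zero.1 hx

/-- The homotopy group of the sphere is generated by the class of a degree one loop. -/
theorem mem_zpowers_phi_one [Nonempty (Fin d)] (p : HomotopyGroup (Fin d) (Sph d) (north d)) :
    p ∈ Subgroup.zpowers (phi (1 : Matrix (Fin d) (Fin d) ℝ)) := by
  obtain ⟨f, rfl⟩ : ∃ f, cls f = p := Quotient.exists_rep p
  obtain ⟨A, hA⟩ := Data.exists_homotopic f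
  obtain ⟨B, g, hAB, hg, hBg, hreg⟩ := exists_regular A
  rw [cls_congr hA, cls_congr hAB]
  refine Data.cls_loop_mem_of_finite _ B.h (fun A' hA' z hz => ?_) B rfl ?_
  · rw [← hA'] at hz
    have hz0 : z ∈ {y | A'.a y ≤ 0 ∧ A'.h y = 0} := hz ▸ Set.mem_singleton z
    have hdet := hreg (emb z) (by rw [← hBg, ← hA']; exact hz0.2)
    rw [cls_loop_eq_phi hz (hg (emb z)).hasFDerivAt hdet fun y => by rw [hA', hBg]]
    exact phi_mem (by rwa [LinearMap.det_toMatrix'])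
  · have hclosed : IsClosed {y | B.a y ≤ 0 ∧ B.h y = 0} :=
      (isClosed_le B.continuous_a continuous_const).inter
        (isClosed_eq B.continuous_h continuous_const)
    refine hclosed.isCompact.finite (IsDiscrete.of_nhdsWithin fun z hz => ?_)
    have hdet := hreg (emb z) (by rw [← hBg]; exact hz.2)
    obtain ⟨C, -, hC⟩ := exists_antilipschitzWith_of_det_ne_zero hdet
    have h1 := (hg (emb z)).hasFDerivAt.eventually_ne (c := 0) ⟨C, hC⟩
    have h2 : ∀ᶠ y in 𝓝 z, y ≠ z → g (emb y) ≠ 0 := by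
      filter_upwards [continuous_emb.continuousAt.eventually (eventually_nhdsWithin_iff.1 h1)]
        with y hy hyz
      exact hy fun h => hyz (emb_injective h)
    rw [Filter.le_pure_iff, mem_nhdsWithin_iff_eventually]
    filter_upwards [h2] with y hy hyB
    by_contra hyz
    exact hy hyz (by rw [← hBg]; exact hyB.2)

section Functoriality

variable {N X Y : Type*} [TopologicalSpace X] [TopologicalSpace Y] {x : X} {y : Y}

/-- Postcomposition of a generalized loop with a pointed map. -/
def mapLoop (Φ : C(X, Y)) (h : Φ x = y) (f : Ω^ N X x) : Ω^ N Y y :=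
  ⟨Φ.comp f.1, fun p hp => (congrArg Φ (f.2 p hp)).trans h⟩

variable [DecidableEq N] [Nonempty N]

/-- The homomorphism of homotopy groups induced by a pointed map. -/
noncomputable def mapHom (Φ : C(X, Y)) (h : Φ x = y) : HomotopyGroup N X x →* HomotopyGroup N Y y :=
  MonoidHom.mk' (Quotient.map (mapLoop Φ h) fun _ _ H => H.comp_continuousMap Φ) fun p q => by
    induction p using Quotient.inductionOn with | _ p
    induction q using Quotient.inductionOn with | _ q
    have i := Classical.arbitrary N
    have h1 : mapLoop Φ h (GenLoop.transAt i q p) =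
        GenLoop.transAt i (mapLoop Φ h q) (mapLoop Φ h p) := by
      ext1 t
      have e1 : GenLoop.transAt i q p t = _ := congrFun (GenLoop.coe_copy _ _) _
      have e2 : GenLoop.transAt i (mapLoop Φ h q) (mapLoop Φ h p) t = _ :=
        congrFun (GenLoop.coe_copy _ _) _
      change Φ (GenLoop.transAt i q p t) = _
      rw [e1, e2, apply_ite Φ]
      rfl
    have e1 := HomotopyGroup.mul_spec (i := i) (p := p) (q := q)
    have e2 := HomotopyGroup.mul_spec (i := i) (p := mapLoop Φ h p) (q := mapLoop Φ h q)
    exact (congrArg _ e1).trans (Eq.trans (congrArg (Quotient.mk _) h1) e2.symm)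

theorem mapHom_comp_mapHom {Φ : C(X, Y)} {h : Φ x = y} {Ψ : C(Y, X)} {h' : Ψ y = x}
    (H : ∀ p, Ψ (Φ p) = p) :
    (mapHom Ψ h').comp (mapHom (N := N) Φ h) = MonoidHom.id _ := by
  ext p
  induction p using Quotient.inductionOn with | _ p
  refine congrArg (Quotient.mk _) ?_
  ext1 t
  exact H _

/-- The isomorphism of homotopy groups induced by a homeomorphism. -/
noncomputable def homotopyGroupCongr (Φ : X ≃ₜ Y) (h : Φ x = y) :
    HomotopyGroup N X x ≃* HomotopyGroup N Y y :=
  MonoidHom.toMulEquiv (mapHom (Φ : C(X, Y)) h)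
    (mapHom (Φ.symm : C(Y, X)) (Φ.symm_apply_eq.2 h.symm))
    (mapHom_comp_mapHom Φ.symm_apply_apply) (mapHom_comp_mapHom Φ.apply_symm_apply)

end Functoriality

/-- The unit sphere is homogeneous. -/
theorem exists_homeomorph_sphere (x y : Sph d) : ∃ Φ : Sph d ≃ₜ Sph d, Φ x = y := by
  have hxy : ‖x.1‖ = ‖y.1‖ := by
    rw [mem_sphere_zero_iff_norm.1 x.2, mem_sphere_zero_iff_norm.1 y.2]
  let e := Submodule.reflection (ℝ ∙ (x.1 - y.1))ᗮ
  refine ⟨e.toHomeomorph.subtype fun v => ?_, Subtype.ext (Submodule.reflection_sub hxy)⟩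
  rw [mem_sphere_zero_iff_norm, mem_sphere_zero_iff_norm]
  change _ ↔ ‖e v‖ = 1
  rw [e.norm_map]

section

variable [Nonempty (Fin d)]

theorem exists_hasDegree_one :
    ∃ f, cls f = phi (1 : Matrix (Fin d) (Fin d) ℝ) ∧ HasDegree f 1 := by
  have h1 : (1 : Matrix (Fin d) (Fin d) ℝ).det ≠ 0 := by simp
  refine ⟨_, (phi_eq h1).symm, ?_⟩
  set A := bump (fun _ => 1 / 2) (1 / 2) (1 : Matrix (Fin d) (Fin d) ℝ) (by norm_num) center_mem h1
  have ha : ∀ y, A.a y = 4 * ‖emb y - fun _ => 1 / 2‖ - 1 := fun y => by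
    change 2 * ‖emb y - fun _ => 1 / 2‖ / (1 / 2) - 1 = _
    ring
  have hh : ∀ y i, A.h y i = y i - 1 / 2 := fun y i => by
    change (1 : Matrix (Fin d) (Fin d) ℝ).mulVec (emb y - fun _ => 1 / 2) i = _
    rw [Matrix.one_mulVec]
    rfl
  have hv : ∀ y, ∃ c : ℝ, 0 < c ∧ (A.loop y).1 = c • dir (A.a y) (A.h y) := fun y => by
    have hne := dir_ne_zero (A.ne_zero y)
    exact ⟨_, inv_pos.2 (norm_pos_iff.2 hne), coe_radial hne⟩
  have hlt : ∀ y (r : ℝ), 0 < r →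
      (‖emb y - (fun _ : Fin d => (1 / 2 : ℝ))‖ < r ↔ ∀ l, |(y l : ℝ) - 1 / 2| < r) :=
    fun y r hr => pi_norm_lt_iff hr
  refine hasDegree_one (fun y => ?_) fun y hy i => ?_
  · obtain ⟨c, hc, hcy⟩ := hv y
    rw [hcy, ← hlt y _ (by norm_num)]
    change c * A.a y < 0 ↔ _
    rw [← not_le, mul_nonneg_iff_of_pos_left hc, not_le, ha]
    constructor <;> intro h <;> linarith
  · obtain ⟨c, hc, hcy⟩ := hv y
    rw [← hlt y _ (by norm_num)] at hy
    rw [hcy]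
    change 0 < c * (max (1 - A.a y) 0 * A.h y i) ↔ _
    rw [mul_pos_iff_of_pos_left hc, mul_pos_iff_of_pos_left (lt_max_of_lt_left _), hh, sub_pos]
    rw [ha]
    linarith

theorem exists_hasDegree_pow (k : ℕ) :
    ∃ f, cls f = phi (1 : Matrix (Fin d) (Fin d) ℝ) ^ k ∧ HasDegree f k := by
  induction k with
  | zero => exact ⟨GenLoop.const, by rw [pow_zero, cls_const], by simpa using hasDegree_const⟩
  | succ k ih =>
    obtain ⟨f, hf, hf'⟩ := ih
    obtain ⟨g, hg, hg'⟩ := exists_hasDegree_one (d := d)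
    refine ⟨GenLoop.transAt (Classical.arbitrary _) f g, ?_, ?_⟩
    · rw [cls_transAt, hf, hg, pow_succ']
    · exact_mod_cast hf'.transAt _ hg'

theorem zpow_phi_one_injective :
    Function.Injective fun k : ℤ => phi (1 : Matrix (Fin d) (Fin d) ℝ) ^ k := by
  rw [injective_zpow_iff_not_isOfFinOrder, isOfFinOrder_iff_pow_eq_one]
  rintro ⟨k, hk, h⟩
  obtain ⟨f, hf, hf'⟩ := exists_hasDegree_pow (d := d) k
  have h1 : GenLoop.Homotopic f GenLoop.const := Quotient.exact (hf.trans (h.trans cls_const.symm))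
  have h2 := (hf'.congr h1).unique hasDegree_const
  omega

/-- The homotopy group of the sphere at the north pole is infinite cyclic. -/
theorem nonempty_mulEquiv_north :
    Nonempty (HomotopyGroup (Fin d) (Sph d) (north d) ≃* Multiplicative ℤ) :=
  ⟨(MulEquiv.ofBijective (M := Multiplicative ℤ)
    (zpowersHom (HomotopyGroup (Fin d) (Sph d) (north d)) (phi (1 : Matrix (Fin d) (Fin d) ℝ)))
    ⟨fun _ _ h => zpow_phi_one_injective h, fun p =>
      let ⟨k, hk⟩ := Subgroup.mem_zpowers_iff.1 (mem_zpowers_phi_one p)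
      ⟨Multiplicative.ofAdd k, hk⟩⟩).symm⟩

end

end SphereDegree

/-- **The Brouwer degree theorem.**
For every natural number `n ≥ 1` (written here as `n + 1` for `n : ℕ`) and any
basepoint `x` on the unit sphere `Sⁿ ⊆ ℝ^{n+1}` (the sphere of radius `1` about
the origin of the `(n+2)`-dimensional Euclidean space `EuclideanSpace ℝ (Fin (n + 2))`,
here `n + 1` plays the role of the dimension), the `(n+1)`-st homotopy group
`π_{n+1}(Sⁿ⁺¹, x)` is isomorphic as a group to the integers `ℤ`. -/
theorem homotopyGroup_sphere_self_iso_int (n : ℕ)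
    (x : Metric.sphere (0 : EuclideanSpace ℝ (Fin (n + 2))) 1) :
    Nonempty ((π_ (n + 1)) (Metric.sphere (0 : EuclideanSpace ℝ (Fin (n + 2))) 1) x ≃*
      Multiplicative ℤ) := by
  obtain ⟨Φ, hΦ⟩ := SphereDegree.exists_homeomorph_sphere x (SphereDegree.north (n + 1))
  obtain ⟨e⟩ := SphereDegree.nonempty_mulEquiv_north (d := n + 1)
  exact ⟨(SphereDegree.homotopyGroupCongr Φ hΦ).trans e⟩
end

section
/- Let P be a group, R a set, and ω : R → P a function. Then there exists a group C, a right action of P on C by group automorphisms, a group homomorphism ∂ : C → P, and a function i : R → C, such that: (a) ∂ together with the P-action is a crossed module (axioms CM1 and CM2 hold); (b) ∂ (i r) = ω r for all r ∈ R; and (c) the pair (C, i) is universal: for every crossed module ν : M → P (with right P-action on M by automorphisms satisfying CM1 and CM2) and every function f : R → M with ν (f r) = ω r for all r ∈ R, there exists a unique group homomorphism φ : C → M which is P-equivariant (φ (c ^ p) = (φ c) ^ p for all c ∈ C, p ∈ P), satisfies ν ∘ φ = ∂, and satisfies φ ∘ i = f. This crossed module is the free crossed P-module on ω. -/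
/-- A crossed module over a group `P`: a group `M` with a right `P`-action by
group automorphisms `act : M → P → M` and a homomorphism `μ : M → P`
satisfying the crossed module axioms (CM1) and (CM2). -/
structure CrossedModuleOver (P : Type) [Group P] : Type 1 where
  /-- The underlying group of the crossed module. -/
  M : Type
  /-- The group structure on `M`. -/
  [grp : Group M]
  /-- The right action of `P` on `M`. -/
  act : M → P → M
  /-- The structural homomorphism `μ : M → P`. -/
  μ : M → P
  μ_mul : ∀ a b : M, μ (a * b) = μ a * μ b
  act_one : ∀ a : M, act a 1 = a
  act_mul : ∀ (a : M) (p q : P), act a (p * q) = act (act a p) q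
  act_hom : ∀ (a b : M) (p : P), act (a * b) p = act a p * act b p
  cm1 : ∀ (a : M) (p : P), μ (act a p) = p⁻¹ * μ a * p
  cm2 : ∀ a b : M, b⁻¹ * a * b = act a (μ b)

attribute [instance] CrossedModuleOver.grp

namespace FreeCrossedModule

variable {P : Type} [Group P] {R : Type}

/-- Right translation by `p` on the free group on the symbols `r ^ q`. -/
def translate (p : P) : FreeGroup (R × P) →* FreeGroup (R × P) :=
  FreeGroup.map fun x => (x.1, x.2 * p)

/-- The boundary of the free precrossed module on `ω`, sending `r ^ p` to `p⁻¹ * ω r * p`. -/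
def boundary (ω : R → P) : FreeGroup (R × P) →* P :=
  FreeGroup.lift fun x => x.2⁻¹ * ω x.1 * x.2

lemma translate_one (a : FreeGroup (R × P)) : translate 1 a = a := by
  simp [translate]

lemma translate_mul (p q : P) (a : FreeGroup (R × P)) :
    translate (p * q) a = translate q (translate p a) := by
  simp [translate, FreeGroup.map.comp, Function.comp_def, mul_assoc]

lemma boundary_translate (ω : R → P) (p : P) (a : FreeGroup (R × P)) :
    boundary ω (translate p a) = p⁻¹ * boundary ω a * p := by
  have h : (boundary ω).comp (translate p) =
      (MulAut.conj p⁻¹).toMonoidHom.comp (boundary ω) := by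
    ext x
    simp [boundary, translate, mul_assoc]
  simpa using DFunLike.congr_fun h a

/-- The Peiffer commutators of the free precrossed module on `ω`. -/
def peifferSet (ω : R → P) : Set (FreeGroup (R × P)) :=
  Set.range fun x : FreeGroup (R × P) × FreeGroup (R × P) =>
    x.2⁻¹ * x.1 * x.2 * (translate (boundary ω x.2) x.1)⁻¹

/-- The Peiffer subgroup of the free precrossed module on `ω`. -/
abbrev peiffer (ω : R → P) : Subgroup (FreeGroup (R × P)) :=
  Subgroup.normalClosure (peifferSet ω)

lemma peiffer_le_ker {G : Type} [Group G] (ω : R → P) (g : FreeGroup (R × P) →* G)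
    (h : ∀ a b, (g b)⁻¹ * g a * g b = g (translate (boundary ω b) a)) :
    peiffer ω ≤ g.ker := by
  apply Subgroup.normalClosure_le_normal
  rintro _ ⟨⟨a, b⟩, rfl⟩
  simp [MonoidHom.mem_ker, h]

lemma mk_peiffer (ω : R → P) (a b : FreeGroup (R × P)) :
    (b : FreeGroup (R × P) ⧸ peiffer ω)⁻¹ * a * b =
      (translate (boundary ω b) a : FreeGroup (R × P)) := by
  have h : b⁻¹ * a * b * (translate (boundary ω b) a)⁻¹ ∈ peiffer ω :=
    Subgroup.subset_normalClosure ⟨(a, b), rfl⟩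
  rw [← QuotientGroup.eq_one_iff] at h
  simpa [mul_inv_eq_one] using h

/-- The boundary induced on the quotient by the Peiffer subgroup. -/
def quotientBoundary (ω : R → P) : FreeGroup (R × P) ⧸ peiffer ω →* P :=
  QuotientGroup.lift _ (boundary ω) <| peiffer_le_ker ω _ fun a b => by
    rw [boundary_translate]

/-- The translation induced on the quotient by the Peiffer subgroup. -/
def quotientTranslate (ω : R → P) (p : P) :
    FreeGroup (R × P) ⧸ peiffer ω →* FreeGroup (R × P) ⧸ peiffer ω :=
  QuotientGroup.lift _ ((QuotientGroup.mk' _).comp (translate p)) <|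
    peiffer_le_ker ω _ fun a b => by
      simp only [MonoidHom.comp_apply, QuotientGroup.mk'_apply]
      rw [mk_peiffer, boundary_translate, ← translate_mul, ← translate_mul]
      simp [mul_assoc]

@[simp]
lemma quotientBoundary_mk (ω : R → P) (a : FreeGroup (R × P)) :
    quotientBoundary ω a = boundary ω a := rfl

@[simp]
lemma quotientTranslate_mk (ω : R → P) (p : P) (a : FreeGroup (R × P)) :
    quotientTranslate ω p a = (translate p a : FreeGroup (R × P)) := rfl

/-- The free crossed `P`-module on `ω`. -/
def free (ω : R → P) : CrossedModuleOver P where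
  M := FreeGroup (R × P) ⧸ peiffer ω
  act a p := quotientTranslate ω p a
  μ := quotientBoundary ω
  μ_mul := map_mul _
  act_one a := by
    induction a using QuotientGroup.induction_on
    simp [translate_one]
  act_mul a p q := by
    induction a using QuotientGroup.induction_on
    simp [translate_mul]
  act_hom a b p := map_mul _ a b
  cm1 a p := by
    induction a using QuotientGroup.induction_on
    simp [boundary_translate]
  cm2 a b := by
    induction a using QuotientGroup.induction_on
    induction b using QuotientGroup.induction_on
    simp [mk_peiffer]

/-- The generators of the free crossed module. -/
def of (ω : R → P) (r : R) : (free ω).M :=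
  QuotientGroup.mk' (peiffer ω) (FreeGroup.of (r, 1))

lemma act_of (ω : R → P) (r : R) (p : P) :
    (free ω).act (of ω r) p = QuotientGroup.mk' (peiffer ω) (FreeGroup.of (r, p)) := by
  simp [free, of, translate]

/-- The homomorphism out of the free group sending `r ^ p` to `(f r) ^ p`. -/
def extend (Y : CrossedModuleOver P) (f : R → Y.M) : FreeGroup (R × P) →* Y.M :=
  FreeGroup.lift fun x => Y.act (f x.1) x.2

lemma extend_translate (Y : CrossedModuleOver P) (f : R → Y.M) (p : P)
    (a : FreeGroup (R × P)) : extend Y f (translate p a) = Y.act (extend Y f a) p := by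
  have h : (extend Y f).comp (translate p) =
      (MonoidHom.mk' (fun m => Y.act m p) fun a b => Y.act_hom a b p).comp (extend Y f) := by
    ext x
    simp [extend, translate, Y.act_mul]
  exact DFunLike.congr_fun h a

lemma μ_extend (Y : CrossedModuleOver P) {f : R → Y.M} {ω : R → P}
    (hf : ∀ r, Y.μ (f r) = ω r) (a : FreeGroup (R × P)) :
    Y.μ (extend Y f a) = boundary ω a := by
  have h : (MonoidHom.mk' Y.μ Y.μ_mul).comp (extend Y f) = boundary ω := by
    ext x
    simp [extend, boundary, Y.cm1, hf]
  exact DFunLike.congr_fun h a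

/-- The morphism from the free crossed module determined by the images of the generators. -/
def lift (Y : CrossedModuleOver P) {f : R → Y.M} {ω : R → P}
    (hf : ∀ r, Y.μ (f r) = ω r) : FreeGroup (R × P) ⧸ peiffer ω →* Y.M :=
  QuotientGroup.lift _ (extend Y f) <| peiffer_le_ker ω _ fun a b => by
    rw [extend_translate, Y.cm2, μ_extend Y hf]

@[simp]
lemma lift_mk (Y : CrossedModuleOver P) {f : R → Y.M} {ω : R → P}
    (hf : ∀ r, Y.μ (f r) = ω r) (a : FreeGroup (R × P)) :
    lift Y hf a = extend Y f a := rfl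

end FreeCrossedModule

/-- **Existence of the free crossed `P`-module on a function `ω : R → P`.**
Given a group `P`, a set `R` and a function `ω : R → P`, there is a crossed
module `∂ : C → P` together with a function `i : R → C` such that `∂ (i r) = ω r`
for all `r`, and which is universal: for every crossed module `ν : M → P` and
every function `f : R → M` with `ν (f r) = ω r` for all `r`, there is a unique
`P`-equivariant group homomorphism `φ : C → M` with `ν ∘ φ = ∂` and `φ ∘ i = f`. -/
theorem exists_free_crossed_module (P : Type) [Group P] (R : Type) (ω : R → P) :
    ∃ (X : CrossedModuleOver P) (i : R → X.M),
      (∀ r : R, X.μ (i r) = ω r) ∧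
      ∀ (Y : CrossedModuleOver P) (f : R → Y.M), (∀ r : R, Y.μ (f r) = ω r) →
        ∃! φ : X.M → Y.M,
          (∀ a b : X.M, φ (a * b) = φ a * φ b) ∧
          (∀ (a : X.M) (p : P), φ (X.act a p) = Y.act (φ a) p) ∧
          (∀ a : X.M, Y.μ (φ a) = X.μ a) ∧
          (∀ r : R, φ (i r) = f r) := by
  refine ⟨FreeCrossedModule.free ω, FreeCrossedModule.of ω, fun r => ?_, fun Y f hf => ?_⟩
  · simp [FreeCrossedModule.free, FreeCrossedModule.of, FreeCrossedModule.boundary]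
  refine ⟨FreeCrossedModule.lift Y hf, ⟨map_mul _, fun a p => ?_, fun a => ?_, fun r => ?_⟩, ?_⟩
  · induction a using QuotientGroup.induction_on
    exact FreeCrossedModule.extend_translate Y f p _
  · induction a using QuotientGroup.induction_on
    exact FreeCrossedModule.μ_extend Y hf _
  · simp [FreeCrossedModule.of, FreeCrossedModule.extend, Y.act_one]
  · rintro φ ⟨hmul, hact, -, hi⟩
    have h : (MonoidHom.mk' φ hmul).comp (QuotientGroup.mk' (FreeCrossedModule.peiffer ω)) =
        FreeCrossedModule.extend Y f := by
      ext ⟨r, p⟩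
      have hr := hact (FreeCrossedModule.of ω r) p
      rw [hi, FreeCrossedModule.act_of] at hr
      exact hr.trans (by simp [FreeCrossedModule.extend])
    funext a
    induction a using QuotientGroup.induction_on with
    | H a => exact DFunLike.congr_fun h a
end
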